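/- arXiv:1108.1035 — 10 statements merged into one kernel-verified Lean document; each statement's English description precedes it below -/
import Mathlib

section
/- Let ω > 0 and let V : ℝ × [0,T] → ℝ be a smooth function with ∂ₓV(x,t) > 0 and ∂ₓₓV(x,t) < 0 for all x ∈ ℝ, t ∈ [0,T], satisfying the fully nonlinear equation ∂ₜV - (ω²/2)(∂ₓV)²/∂ₓₓV = 0. Then the Riccati-transformed function φ(x,t) := -(1/ω) ∂ₓₓV(x,t)/∂ₓV(x,t) satisfies the fully nonlinear parabolic equation ∂ₜφ + (1/2) ∂ₓ( φ⁻² ∂ₓφ ) = 0, i.e. ∂ₜφ + (1/2)( φ⁻² ∂ₓₓφ - 2 φ⁻³ (∂ₓφ)² ) = 0, at every point (x,t). -/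
/-- The partial derivative of `F` in direction `v`, as a function on the plane. -/
noncomputable def partialDeriv (v : ℝ × ℝ) (F : ℝ × ℝ → ℝ) (p : ℝ × ℝ) : ℝ := fderiv ℝ F p v

theorem ContDiff.partialDeriv {F : ℝ × ℝ → ℝ} (hF : ContDiff ℝ (⊤ : ℕ∞) F) (v : ℝ × ℝ) :
    ContDiff ℝ (⊤ : ℕ∞) (partialDeriv v F) :=
  (hF.fderiv_right (m := (⊤ : ℕ∞)) (by simp)).clm_apply contDiff_const

theorem ContDiff.hasDerivAt_fst {F : ℝ × ℝ → ℝ} (hF : ContDiff ℝ (⊤ : ℕ∞) F) (x t : ℝ) :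
    HasDerivAt (fun y => F (y, t)) (_root_.partialDeriv (1, 0) F (x, t)) x :=
  ((hF.differentiable (by simp)) (x, t)).hasFDerivAt.comp_hasDerivAt x
    ((hasDerivAt_id x).prodMk (hasDerivAt_const x t))

theorem ContDiff.hasDerivAt_snd {F : ℝ × ℝ → ℝ} (hF : ContDiff ℝ (⊤ : ℕ∞) F) (x t : ℝ) :
    HasDerivAt (fun s => F (x, s)) (_root_.partialDeriv (0, 1) F (x, t)) t :=
  ((hF.differentiable (by simp)) (x, t)).hasFDerivAt.comp_hasDerivAt t
    ((hasDerivAt_const t x).prodMk (hasDerivAt_id t))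

theorem ContDiff.partialDeriv_comm {F : ℝ × ℝ → ℝ} (hF : ContDiff ℝ (⊤ : ℕ∞) F)
    (v w : ℝ × ℝ) :
    _root_.partialDeriv v (_root_.partialDeriv w F)
      = _root_.partialDeriv w (_root_.partialDeriv v F) := by
  funext p
  have hd : DifferentiableAt ℝ (fderiv ℝ F) p :=
    (hF.fderiv_right (m := (⊤ : ℕ∞)) (by simp)).differentiable (by simp) p
  have key : ∀ v w : ℝ × ℝ,
      _root_.partialDeriv v (_root_.partialDeriv w F) p = fderiv ℝ (fderiv ℝ F) p v w := by
    intro v w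
    have h := hd.hasFDerivAt.clm_apply (hasFDerivAt_const w p)
    change fderiv ℝ (fun q => fderiv ℝ F q w) p v = _
    rw [h.fderiv]
    simp
  rw [key, key]
  exact (hF.contDiffAt.isSymmSndFDerivAt (by
    rw [minSmoothness_of_isRCLikeNormedField]; exact WithTop.coe_le_coe.2 (le_top : (2 : ℕ∞) ≤ ⊤))) v w

/-- Let `ω > 0` and let `V : ℝ × [0,T] → ℝ` be a smooth function with `∂ₓV > 0` and
`∂ₓₓV < 0` on `ℝ × [0,T]`, satisfying `∂ₜV - (ω²/2)(∂ₓV)²/∂ₓₓV = 0`.  Then the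
Riccati-transformed function `φ := -(1/ω) ∂ₓₓV/∂ₓV` satisfies
`∂ₜφ + (1/2)(φ⁻² ∂ₓₓφ - 2 φ⁻³ (∂ₓφ)²) = 0` at every point `(x,t)`. -/
theorem stmt_0 (ω T : ℝ) (hω : 0 < ω) (V φ : ℝ → ℝ → ℝ)
    (hsmooth : ContDiff ℝ (⊤ : ℕ∞) (fun p : ℝ × ℝ => V p.1 p.2))
    (hVx : ∀ x t, t ∈ Set.Icc 0 T → 0 < deriv (fun y => V y t) x)
    (hVxx : ∀ x t, t ∈ Set.Icc 0 T → deriv (deriv (fun y => V y t)) x < 0)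
    (hPDE : ∀ x t, t ∈ Set.Icc 0 T →
      deriv (fun s => V x s) t
        - ω ^ 2 / 2 * (deriv (fun y => V y t) x) ^ 2
            / deriv (deriv (fun y => V y t)) x = 0)
    (hφ : ∀ x t, φ x t
        = -(1 / ω) * (deriv (deriv (fun y => V y t)) x / deriv (fun y => V y t) x)) :
    ∀ x t, t ∈ Set.Icc 0 T →
      deriv (fun s => φ x s) t
        + 1 / 2 * (((φ x t) ^ 2)⁻¹ * deriv (deriv (fun y => φ y t)) x
            - 2 * ((φ x t) ^ 3)⁻¹ * (deriv (fun y => φ y t) x) ^ 2) = 0 := by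
  intro x t ht
  set U : ℝ × ℝ → ℝ := fun p => V p.1 p.2 with hU
  set a := partialDeriv (1, 0) U with ha
  set b := partialDeriv (1, 0) a with hb
  set c := partialDeriv (1, 0) b with hc
  set d := partialDeriv (1, 0) c with hd
  set g := partialDeriv (0, 1) U with hg
  have sa : ContDiff ℝ (⊤ : ℕ∞) a := hsmooth.partialDeriv _
  have sb : ContDiff ℝ (⊤ : ℕ∞) b := sa.partialDeriv _
  have sc : ContDiff ℝ (⊤ : ℕ∞) c := sb.partialDeriv _
  have sg : ContDiff ℝ (⊤ : ℕ∞) g := hsmooth.partialDeriv _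
  have sgx := sg.partialDeriv (1, 0)
  have e1 : ∀ t, deriv (fun y => V y t) = fun x => a (x, t) := fun t =>
    funext fun x => (hsmooth.hasDerivAt_fst x t).deriv
  have e2 : ∀ t, deriv (fun x => a (x, t)) = fun x => b (x, t) := fun t =>
    funext fun x => (sa.hasDerivAt_fst x t).deriv
  have e3 : ∀ x t, deriv (fun s => V x s) t = g (x, t) := fun x t =>
    (hsmooth.hasDerivAt_snd x t).deriv
  simp only [e1, e2, e3] at hVx hVxx hPDE hφ
  have na : ∀ x, a (x, t) ≠ 0 := fun x => (hVx x t ht).ne'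
  have nb : ∀ x, b (x, t) ≠ 0 := fun x => (hVxx x t ht).ne
  have nω : ω ≠ 0 := hω.ne'
  have da := fun x => sa.hasDerivAt_fst x t
  have db := fun x => sb.hasDerivAt_fst x t
  have dc := fun x => sc.hasDerivAt_fst x t
  rw [← hb] at da
  rw [← hc] at db
  rw [← hd] at dc
  have g0 : (fun x => g (x, t)) = fun x => ω ^ 2 / 2 * a (x, t) ^ 2 / b (x, t) :=
    funext fun x => sub_eq_zero.mp (hPDE x t ht)
  have g1 : (fun x => partialDeriv (1, 0) g (x, t)) =
      fun x => ω ^ 2 / 2 * (2 * a (x, t) - a (x, t) ^ 2 * c (x, t) / b (x, t) ^ 2) := by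
    funext x
    have h := sg.hasDerivAt_fst x t
    rw [g0] at h
    rw [h.unique ((((da x).pow 2).const_mul (ω ^ 2 / 2)).div (db x) (nb x))]
    have := nb x
    simp only [Pi.pow_apply]
    field_simp
    push_cast
    ring
  have g2 : partialDeriv (1, 0) (partialDeriv (1, 0) g) (x, t) =
      ω ^ 2 / 2 * (2 * b (x, t) - 2 * a (x, t) * c (x, t) / b (x, t)
        - a (x, t) ^ 2 * d (x, t) / b (x, t) ^ 2
        + 2 * a (x, t) ^ 2 * c (x, t) ^ 2 / b (x, t) ^ 3) := by
    have h := sgx.hasDerivAt_fst x t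
    rw [g1] at h
    rw [h.unique ((((da x).const_mul 2).sub ((((da x).pow 2).mul (dc x)).div ((db x).pow 2)
      (pow_ne_zero 2 (nb x)))).const_mul (ω ^ 2 / 2))]
    have := nb x
    simp only [Pi.pow_apply, Pi.mul_apply]
    field_simp
    push_cast
    ring
  have ta : HasDerivAt (fun s => a (x, s)) (partialDeriv (1, 0) g (x, t)) t := by
    have h := sa.hasDerivAt_snd x t
    rwa [ha, hsmooth.partialDeriv_comm] at h
  have tb : HasDerivAt (fun s => b (x, s))
      (partialDeriv (1, 0) (partialDeriv (1, 0) g) (x, t)) t := by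
    have h := sb.hasDerivAt_snd x t
    rwa [hb, sa.partialDeriv_comm, ha, hsmooth.partialDeriv_comm (0, 1)] at h
  have p1 : deriv (fun y => φ y t) = fun x =>
      -(1 / ω) * ((c (x, t) * a (x, t) - b (x, t) * b (x, t)) / a (x, t) ^ 2) := by
    funext x
    simp only [hφ]
    exact (((db x).div (da x) (na x)).const_mul _).deriv
  have p2 : deriv (fun x =>
      -(1 / ω) * ((c (x, t) * a (x, t) - b (x, t) * b (x, t)) / a (x, t) ^ 2)) x = _ :=
    ((((((dc x).mul (da x)).sub ((db x).mul (db x))).div ((da x).pow 2)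
    (pow_ne_zero 2 (na x)))).const_mul (-(1 / ω))).deriv
  have pt : deriv (fun s => φ x s) t =
      -(1 / ω) * ((partialDeriv (1, 0) (partialDeriv (1, 0) g) (x, t) * a (x, t)
        - b (x, t) * partialDeriv (1, 0) g (x, t)) / a (x, t) ^ 2) := by
    simp only [hφ]
    exact ((tb.div ta (na x)).const_mul (-(1 / ω))).deriv
  rw [pt, p1, p2, hφ, g2, congrFun g1 x]
  have := na x
  have := nb x
  simp only [Pi.pow_apply, Pi.mul_apply, Pi.sub_apply]
  field_simp
  push_cast
  ring
end

section
/- Let ω > 0 and let V : ℝ × [0,T] → ℝ be a smooth function with ∂ₓV(x,t) > 0 for all x ∈ ℝ, t ∈ [0,T], satisfying the linear parabolic equation ∂ₜV + (1/2)∂ₓₓV + ω ∂ₓV = 0. Then the Riccati-transformed function φ(x,t) := -(1/ω) ∂ₓₓV(x,t)/∂ₓV(x,t) satisfies the equation ∂ₜφ + (1/2) ∂ₓ( ∂ₓφ - ω(1-φ)² ) = 0, i.e. ∂ₜφ + (1/2)∂ₓₓφ + ω(1-φ)∂ₓφ = 0, at every point (x,t). -/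
/-- The directional derivative of a smooth function is smooth. -/
lemma contDiff_fderiv_apply {F : ℝ × ℝ → ℝ} (hF : ContDiff ℝ (⊤ : ℕ∞) F) (v : ℝ × ℝ) :
    ContDiff ℝ (⊤ : ℕ∞) (fun p => fderiv ℝ F p v) :=
  (hF.fderiv_right (m := (⊤ : ℕ∞)) (by simp)).clm_apply contDiff_const

lemma hasDerivAt_fst_of_contDiff {F : ℝ × ℝ → ℝ} (hF : ContDiff ℝ (⊤ : ℕ∞) F) (x t : ℝ) :
    HasDerivAt (fun y => F (y, t)) (fderiv ℝ F (x, t) (1, 0)) x :=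
  ((hF.differentiable (by simp)) (x, t)).hasFDerivAt.comp_hasDerivAt x
    ((hasDerivAt_id x).prodMk (hasDerivAt_const x t))

lemma hasDerivAt_snd_of_contDiff {F : ℝ × ℝ → ℝ} (hF : ContDiff ℝ (⊤ : ℕ∞) F) (x t : ℝ) :
    HasDerivAt (fun s => F (x, s)) (fderiv ℝ F (x, t) (0, 1)) t :=
  ((hF.differentiable (by simp)) (x, t)).hasFDerivAt.comp_hasDerivAt t
    ((hasDerivAt_const t x).prodMk (hasDerivAt_id t))

/-- Directional derivatives of a smooth function commute. -/
lemma fderiv_fderiv_apply_comm {F : ℝ × ℝ → ℝ} (hF : ContDiff ℝ (⊤ : ℕ∞) F)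
    (v w p : ℝ × ℝ) :
    fderiv ℝ (fun q => fderiv ℝ F q v) p w = fderiv ℝ (fun q => fderiv ℝ F q w) p v := by
  have hd : DifferentiableAt ℝ (fderiv ℝ F) p :=
    (hF.fderiv_right (m := (⊤ : ℕ∞)) (by simp)).differentiable (by simp) p
  have hs : IsSymmSndFDerivAt ℝ F p := hF.contDiffAt.isSymmSndFDerivAt
    (by simpa using WithTop.coe_le_coe.2 (le_top : (2 : ℕ∞) ≤ ⊤))
  rw [fderiv_clm_apply hd (differentiableAt_const v),
    fderiv_clm_apply hd (differentiableAt_const w)]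
  simpa using hs.eq w v


/-- Let `ω > 0` and let `V` be a smooth function with `∂ₓV > 0` on `ℝ × [0,T]`
satisfying the linear parabolic equation `∂ₜV + (1/2)∂ₓₓV + ω ∂ₓV = 0`.
Then `φ := -(1/ω) ∂ₓₓV/∂ₓV` satisfies
`∂ₜφ + (1/2)∂ₓₓφ + ω(1-φ)∂ₓφ = 0` at every point `(x,t)`. -/
theorem stmt_1 (ω T : ℝ) (hω : 0 < ω) (V φ : ℝ → ℝ → ℝ)
    (hsmooth : ContDiff ℝ (⊤ : ℕ∞) (fun p : ℝ × ℝ => V p.1 p.2))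
    (hVx : ∀ x t, t ∈ Set.Icc 0 T → 0 < deriv (fun y => V y t) x)
    (hPDE : ∀ x t, t ∈ Set.Icc 0 T →
      deriv (fun s => V x s) t + 1 / 2 * deriv (deriv (fun y => V y t)) x
        + ω * deriv (fun y => V y t) x = 0)
    (hφ : ∀ x t, φ x t
        = -(1 / ω) * (deriv (deriv (fun y => V y t)) x / deriv (fun y => V y t) x)) :
    ∀ x t, t ∈ Set.Icc 0 T →
      deriv (fun s => φ x s) t + 1 / 2 * deriv (deriv (fun y => φ y t)) x
        + ω * (1 - φ x t) * deriv (fun y => φ y t) x = 0 := by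
  intro x t ht
  set F : ℝ × ℝ → ℝ := fun p => V p.1 p.2 with hF
  set A : ℝ × ℝ → ℝ := fun p => fderiv ℝ F p (1, 0) with hA
  set B : ℝ × ℝ → ℝ := fun p => fderiv ℝ A p (1, 0) with hB
  set C : ℝ × ℝ → ℝ := fun p => fderiv ℝ B p (1, 0) with hC
  set D : ℝ × ℝ → ℝ := fun p => fderiv ℝ C p (1, 0) with hD
  set G : ℝ × ℝ → ℝ := fun p => fderiv ℝ F p (0, 1) with hG
  have sA : ContDiff ℝ (⊤ : ℕ∞) A := contDiff_fderiv_apply hsmooth _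
  have sB : ContDiff ℝ (⊤ : ℕ∞) B := contDiff_fderiv_apply sA _
  have sC : ContDiff ℝ (⊤ : ℕ∞) C := contDiff_fderiv_apply sB _
  have dV (s : ℝ) : deriv (fun y => V y s) = fun y => A (y, s) :=
    funext fun y => (hasDerivAt_fst_of_contDiff hsmooth y s).deriv
  have dA (y s : ℝ) : HasDerivAt (fun y => A (y, s)) (B (y, s)) y :=
    hasDerivAt_fst_of_contDiff sA y s
  have dB (y s : ℝ) : HasDerivAt (fun y => B (y, s)) (C (y, s)) y :=
    hasDerivAt_fst_of_contDiff sB y s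
  have dC (y s : ℝ) : HasDerivAt (fun y => C (y, s)) (D (y, s)) y :=
    hasDerivAt_fst_of_contDiff sC y s
  have dVV (y s : ℝ) : deriv (deriv (fun y => V y s)) y = B (y, s) := by
    rw [dV]; exact (dA y s).deriv
  have dVt (y s : ℝ) : deriv (fun s => V y s) s = G (y, s) :=
    (hasDerivAt_snd_of_contDiff hsmooth y s).deriv
  have hApos (y : ℝ) : A (y, t) ≠ 0 := by
    have := hVx y t ht
    rw [dV] at this
    exact this.ne'
  have hGeq : (fun y => G (y, t)) = fun y => -(1 / 2) * B (y, t) - ω * A (y, t) := by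
    funext y
    have := hPDE y t ht
    rw [dVt, dVV, dV] at this
    linarith
  -- Differentiating the equation for `V` in `x` gives the time derivatives of `∂ₓV` and `∂ₓₓV`.
  have hAt (y : ℝ) : fderiv ℝ A (y, t) (0, 1) = -(1 / 2) * C (y, t) - ω * B (y, t) := by
    have h := hasDerivAt_fst_of_contDiff (contDiff_fderiv_apply hsmooth (0, 1)) y t
    change HasDerivAt (fun y => G (y, t)) _ y at h
    rw [hGeq] at h
    rw [hA, fderiv_fderiv_apply_comm hsmooth]
    exact h.unique (((dB y t).const_mul _).sub ((dA y t).const_mul _))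
  have hBt : fderiv ℝ B (x, t) (0, 1) = -(1 / 2) * D (x, t) - ω * C (x, t) := by
    have h := hasDerivAt_fst_of_contDiff (contDiff_fderiv_apply sA (0, 1)) x t
    simp only [hAt] at h
    rw [hB, fderiv_fderiv_apply_comm sA]
    exact h.unique (((dC x t).const_mul _).sub ((dB x t).const_mul _))
  have hφ' (y s : ℝ) : φ y s = -(1 / ω) * (B (y, s) / A (y, s)) := by
    rw [hφ, dVV, dV]
  have hφt := ((hasDerivAt_snd_of_contDiff sB x t).div
    (hasDerivAt_snd_of_contDiff sA x t) (hApos x)).const_mul (-(1 / ω))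
  have hφx (y : ℝ) := ((dB y t).div (dA y t) (hApos y)).const_mul (-(1 / ω))
  have hφxx := ((((dC x t).mul (dA x t)).sub ((dB x t).mul (dB x t))).div
    ((dA x t).pow 2) (pow_ne_zero 2 (hApos x))).const_mul (-(1 / ω))
  have e0 (s : ℝ) : (fun y => φ y s) = fun y => -(1 / ω) * (B (y, s) / A (y, s)) :=
    funext fun y => hφ' y s
  have e1 : (fun s => φ x s) = fun s => -(1 / ω) * (B (x, s) / A (x, s)) :=
    funext fun s => hφ' x s
  have e2 := funext fun y => (hφx y).deriv
  have e3 := hφxx.deriv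
  have e4 := hφt.deriv
  simp only [Pi.div_def, Pi.mul_def, Pi.sub_def, Pi.pow_def] at e2 e3 e4
  rw [← e0] at e2
  rw [← e1] at e4
  simp only [pow_two] at e2 e3
  rw [e2, e3, e4, hφ', hAt, hBt]
  have := hApos x
  have := hω.ne'
  push_cast
  field_simp
  ring
end

section
/- Let ω > 0 and c, K₀ ∈ ℝ satisfy c > 0, K₀ + c < 0 and K₀ + ω/2 > 0. Then the numbers z⁻ = 1 + c/(2K₀) and z⁺ = 1/2 - c/(2ω) - (1/2)√(c²/ω² - 2(c+K₀)/ω) are well defined (the expression under the square root is positive), satisfy 0 < z⁺ < 1/2 < z⁻ < 1, are the only zeros of F in the interval (0,1), and moreover F′(z⁻) > 0, F′(z⁺) < 0, and F(z) < 0 for all z with z⁺ < z < z⁻. -/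
/-- The function `F`: `F(z) = K₀ + 2cz + (ω/2)(1-2z)²` for `z < 1/2`,
`F(z) = K₀ + c/(2(1-z))` for `1/2 ≤ z < 1`. -/
noncomputable def Fsimple (ω c K₀ z : ℝ) : ℝ :=
  if z < 1 / 2 then K₀ + 2 * c * z + ω / 2 * (1 - 2 * z) ^ 2 else K₀ + c / (2 * (1 - z))

theorem Fsimple_of_lt {ω c K₀ s z : ℝ} (hω : ω ≠ 0)
    (hs : s ^ 2 = c ^ 2 / ω ^ 2 - 2 * (c + K₀) / ω) (hz : z < 1 / 2) :
    Fsimple ω c K₀ z =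
      ω * ((1 / 2 - c / (2 * ω) - 1 / 2 * s) - z) * (1 - 2 * z + (s - c / ω)) := by
  have hs' : ω * s ^ 2 = c ^ 2 / ω - 2 * (c + K₀) := by
    rw [hs]
    field_simp
  rw [Fsimple, if_pos hz]
  have key : ω * ((1 / 2 - c / (2 * ω) - 1 / 2 * s) - z) * (1 - 2 * z + (s - c / ω)) =
      1 / 2 * (ω * (1 - 2 * z) ^ 2 - 2 * c * (1 - 2 * z) + c ^ 2 / ω - ω * s ^ 2) := by
    field_simp
    ring
  rw [key, hs']
  ring

theorem Fsimple_of_le {ω c K₀ z : ℝ} (hK : K₀ ≠ 0) (hz : 1 / 2 ≤ z) (hz1 : z < 1) :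
    Fsimple ω c K₀ z = K₀ * ((1 + c / (2 * K₀)) - z) / (1 - z) := by
  have h : 1 - z ≠ 0 := by linarith
  rw [Fsimple, if_neg hz.not_gt]
  field_simp
  ring

theorem hasDerivAt_Fsimple_of_lt {ω c K₀ z : ℝ} (hz : z < 1 / 2) :
    HasDerivAt (Fsimple ω c K₀) (2 * c - 2 * ω * (1 - 2 * z)) z := by
  have hlin : HasDerivAt (fun x : ℝ => 1 - 2 * x) (-(2 * 1)) z :=
    ((hasDerivAt_id z).const_mul 2).const_sub 1
  have h := (((hasDerivAt_id z).const_mul (2 * c)).const_add K₀).add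
    ((hlin.pow 2).const_mul (ω / 2))
  refine (h.congr_deriv (by norm_num; ring)).congr_of_eventuallyEq ?_
  filter_upwards [Iio_mem_nhds hz] with x hx
  simp only [Fsimple, if_pos (Set.mem_Iio.mp hx), Pi.add_apply, Pi.pow_apply, id]

theorem hasDerivAt_Fsimple_of_gt {ω c K₀ z : ℝ} (hz : 1 / 2 < z) (hz1 : z < 1) :
    HasDerivAt (Fsimple ω c K₀) (c / (2 * (1 - z) ^ 2)) z := by
  have hne : 1 - z ≠ 0 := by linarith
  have hlin : HasDerivAt (fun x : ℝ => 2 * (1 - x)) (2 * (-1)) z :=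
    ((hasDerivAt_id z).const_sub 1).const_mul 2
  have h := ((hasDerivAt_const z c).div hlin (mul_ne_zero two_ne_zero hne)).const_add K₀
  refine (h.congr_deriv (by field_simp; ring)).congr_of_eventuallyEq ?_
  filter_upwards [Ioi_mem_nhds hz] with x hx
  simp only [Fsimple, if_neg (Set.mem_Ioi.mp hx).not_gt, Pi.div_apply]

/-- Let `ω > 0`, `c > 0`, `K₀ + c < 0` and `K₀ + ω/2 > 0`.  Then
`z⁻ = 1 + c/(2K₀)` and `z⁺ = 1/2 - c/(2ω) - (1/2)√(c²/ω² - 2(c+K₀)/ω)` are well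
defined (the radicand is positive), satisfy `0 < z⁺ < 1/2 < z⁻ < 1`, are the only
zeros of `F` in `(0,1)`, and moreover `F′(z⁻) > 0`, `F′(z⁺) < 0`, and `F(z) < 0`
for `z⁺ < z < z⁻`. -/
theorem stmt_3 (ω c K₀ : ℝ) (hω : 0 < ω) (hc : 0 < c) (hKc : K₀ + c < 0)
    (hKω : 0 < K₀ + ω / 2) :
    0 < c ^ 2 / ω ^ 2 - 2 * (c + K₀) / ω ∧
    (let zm : ℝ := 1 + c / (2 * K₀)
     let zp : ℝ := 1 / 2 - c / (2 * ω)
        - 1 / 2 * Real.sqrt (c ^ 2 / ω ^ 2 - 2 * (c + K₀) / ω)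
     0 < zp ∧ zp < 1 / 2 ∧ 1 / 2 < zm ∧ zm < 1 ∧
     Fsimple ω c K₀ zp = 0 ∧ Fsimple ω c K₀ zm = 0 ∧
     (∀ z ∈ Set.Ioo (0 : ℝ) 1, Fsimple ω c K₀ z = 0 → z = zp ∨ z = zm) ∧
     0 < deriv (Fsimple ω c K₀) zm ∧ deriv (Fsimple ω c K₀) zp < 0 ∧
     (∀ z : ℝ, zp < z → z < zm → Fsimple ω c K₀ z < 0)) := by
  have hK : K₀ < 0 := by linarith
  have ha : 0 < c / ω := div_pos hc hω
  have hrad : (c / ω) ^ 2 < c ^ 2 / ω ^ 2 - 2 * (c + K₀) / ω := by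
    have : 2 * (c + K₀) / ω < 0 := div_neg_of_neg_of_pos (by linarith) hω
    rw [div_pow]
    linarith
  have hpos := (sq_nonneg (c / ω)).trans_lt hrad
  refine ⟨hpos, ?_⟩
  intro zm zp
  set s := Real.sqrt (c ^ 2 / ω ^ 2 - 2 * (c + K₀) / ω)
  have hs : s ^ 2 = c ^ 2 / ω ^ 2 - 2 * (c + K₀) / ω := Real.sq_sqrt hpos.le
  have has : c / ω < s := Real.lt_sqrt_of_sq_lt hrad
  have hs1 : s < 1 - c / ω := by
    have ha1 : c / ω < 1 := by
      rw [div_lt_one hω]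
      linarith
    refine (Real.sqrt_lt' (by linarith)).2 ?_
    have hgap : (1 - c / ω) ^ 2 - (c ^ 2 / ω ^ 2 - 2 * (c + K₀) / ω) =
        2 * (K₀ + ω / 2) / ω := by
      field_simp
      ring
    have : 0 < 2 * (K₀ + ω / 2) / ω := by positivity
    linarith
  have hzp : zp = 1 / 2 - c / ω / 2 - 1 / 2 * s := by
    have : c / (2 * ω) = c / ω / 2 := by field_simp
    rw [← this]
  have hzp_pos : 0 < zp := by linarith
  have hzp_lt : zp < 1 / 2 := by linarith
  have hzm_gt : 1 / 2 < zm := by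
    have : -(1 / 2) < c / (2 * K₀) := by
      rw [lt_div_iff_of_neg (by linarith)]
      linarith
    simp only [zm]
    linarith
  have hzm_lt : zm < 1 := by
    have : c / (2 * K₀) < 0 := div_neg_of_pos_of_neg hc (by linarith)
    simp only [zm]
    linarith
  have hleft : ∀ z < 1 / 2, Fsimple ω c K₀ z = ω * (zp - z) * (1 - 2 * z + (s - c / ω)) :=
    fun z hz => Fsimple_of_lt hω.ne' hs hz
  have hright : ∀ z, 1 / 2 ≤ z → z < 1 → Fsimple ω c K₀ z = K₀ * (zm - z) / (1 - z) :=
    fun z hz hz1 => Fsimple_of_le hK.ne hz hz1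
  refine ⟨hzp_pos, hzp_lt, hzm_gt, hzm_lt, ?_, ?_, ?_, ?_, ?_, ?_⟩
  · rw [hleft zp hzp_lt]
    ring
  · rw [hright zm hzm_gt.le hzm_lt]
    simp
  · rintro z ⟨-, hz1⟩ hF
    rcases lt_or_ge z (1 / 2) with hz | hz
    · have hfac : 1 - 2 * z + (s - c / ω) ≠ 0 := by linarith
      rw [hleft z hz, mul_eq_zero_iff_right hfac, mul_eq_zero_iff_left hω.ne'] at hF
      exact Or.inl (sub_eq_zero.mp hF).symm
    · rw [hright z hz hz1, div_eq_zero_iff, mul_eq_zero_iff_left hK.ne] at hF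
      rcases hF with hF | hF
      · exact Or.inr (sub_eq_zero.mp hF).symm
      · linarith
  · rw [(hasDerivAt_Fsimple_of_gt hzm_gt hzm_lt).deriv]
    have : 0 < 1 - zm := by linarith
    positivity
  · rw [(hasDerivAt_Fsimple_of_lt hzp_lt).deriv]
    have hval : 2 * c - 2 * ω * (1 - 2 * zp) = -(2 * ω * s) := by
      rw [hzp]
      field_simp
      ring
    have : 0 < s := ha.trans has
    rw [hval, neg_lt_zero]
    positivity
  · intro z hzp_z hz_zm
    rcases lt_or_ge z (1 / 2) with hz | hz
    · rw [hleft z hz]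
      exact mul_neg_of_neg_of_pos (mul_neg_of_pos_of_neg hω (by linarith)) (by linarith)
    · rw [hright z hz (hz_zm.trans hzm_lt)]
      exact div_neg_of_neg_of_pos (mul_neg_of_neg_of_pos hK (by linarith)) (by linarith)
end

section
/- Let a < b be real numbers and let F be a continuously differentiable real-valued function on an open interval containing [a,b] such that F(a) = F(b) = 0 and F(z) < 0 for all z ∈ (a,b). Then there exists a continuously differentiable, strictly decreasing function z : ℝ → ℝ with a < z(ξ) < b for all ξ, z′(ξ) = F(z(ξ)) for all ξ ∈ ℝ, z(ξ) → b as ξ → -∞ and z(ξ) → a as ξ → +∞. Moreover this solution is unique up to a shift of the argument: if z₁, z₂ are two such solutions then there exists ξ₀ ∈ ℝ with z₂(ξ) = z₁(ξ + ξ₀) for all ξ ∈ ℝ. -/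
/-- `z : ℝ → ℝ` is a decreasing heteroclinic connection of the scalar autonomous
ODE `z' = F(z)` from `b` (at `-∞`) to `a` (at `+∞`). -/
def IsDecreasingConnection (F : ℝ → ℝ) (a b : ℝ) (z : ℝ → ℝ) : Prop :=
  ContDiff ℝ 1 z ∧ StrictAnti z ∧ (∀ ξ, z ξ ∈ Set.Ioo a b) ∧
  (∀ ξ, deriv z ξ = F (z ξ)) ∧
  Filter.Tendsto z Filter.atBot (nhds b) ∧ Filter.Tendsto z Filter.atTop (nhds a)

open Set Filter Topology

/-- On an open interval where the right-hand side `f` does not vanish, the time map of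
`z' = f(z)` is a primitive of `1 / f`. -/
theorem exists_hasDerivAt_inv {f : ℝ → ℝ} {a b : ℝ} (hab : a < b)
    (hf : ContinuousOn f (Ioo a b)) (hne : ∀ y ∈ Ioo a b, f y ≠ 0) :
    ∃ T : ℝ → ℝ, ∀ y ∈ Ioo a b, HasDerivAt T (f y)⁻¹ y := by
  obtain ⟨c, hc⟩ := nonempty_Ioo.2 hab
  have hinv : ContinuousOn (fun y => (f y)⁻¹) (Ioo a b) := hf.inv₀ hne
  refine ⟨fun y => ∫ x in c..y, (f x)⁻¹, fun y hy => ?_⟩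
  have hsub : uIcc c y ⊆ Ioo a b := ordConnected_Ioo.uIcc_subset hc hy
  exact intervalIntegral.integral_hasDerivAt_right (hinv.mono hsub).intervalIntegrable
    (hinv.stronglyMeasurableAtFilter isOpen_Ioo y hy)
    (hinv.continuousAt (isOpen_Ioo.mem_nhds hy))

/-- The time map of a negative `F` bounded below by `-K (y - a)` blows up at `a`. -/
theorem tendsto_timeMap_left {F T : ℝ → ℝ} {a b K : ℝ} (hab : a < b) (hK : 0 < K)
    (hneg : ∀ y ∈ Ioo a b, F y < 0) (hbound : ∀ y ∈ Ioo a b, -F y ≤ K * (y - a))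
    (hT : ∀ y ∈ Ioo a b, HasDerivAt T (F y)⁻¹ y) :
    Tendsto T (𝓝[>] a) atTop := by
  obtain ⟨c, hc⟩ := nonempty_Ioo.2 hab
  have hH : ∀ y ∈ Ioo a b, HasDerivAt (fun x => T x + K⁻¹ * Real.log (x - a))
      ((F y)⁻¹ + K⁻¹ * (1 / (y - a))) y := fun y hy =>
    (hT y hy).add ((((hasDerivAt_id y).sub_const a).log (sub_pos.2 hy.1).ne').const_mul K⁻¹)
  have hanti : AntitoneOn (fun x => T x + K⁻¹ * Real.log (x - a)) (Ioo a b) := by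
    refine antitoneOn_of_hasDerivWithinAt_nonpos (convex_Ioo a b)
      (fun y hy => (hH y hy).continuousAt.continuousWithinAt)
      (fun y hy => (hH y (interior_subset hy)).hasDerivWithinAt) fun y hy => ?_
    have hy := interior_subset hy
    have h := inv_anti₀ (neg_pos.2 (hneg y hy)) (hbound y hy)
    rw [inv_neg, mul_inv] at h
    rw [one_div]
    linarith
  have hlog : Tendsto (fun y => Real.log (y - a)) (𝓝[>] a) atBot := by
    refine Real.tendsto_log_nhdsGT_zero.comp (tendsto_nhdsWithin_iff.2 ⟨?_, ?_⟩)
    · exact ((continuous_id.sub continuous_const).tendsto' a 0 (by simp)).mono_left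
        nhdsWithin_le_nhds
    · filter_upwards [self_mem_nhdsWithin] with y hy using sub_pos.2 (mem_Ioi.1 hy)
  refine tendsto_atTop_mono' _ ?_ (tendsto_atTop_add_const_left _
    (T c + K⁻¹ * Real.log (c - a))
    (tendsto_neg_atBot_atTop.comp (hlog.const_mul_atBot (inv_pos.2 hK))))
  filter_upwards [Ioo_mem_nhdsGT hc.1] with y hy
  have h := hanti ⟨hy.1, hy.2.trans hc.2⟩ hc hy.2.le
  simp only [Function.comp_apply] at h ⊢
  linarith

/-- The time map of a negative `F` bounded below by `-K (b - y)` tends to `-∞` at `b`. -/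
theorem tendsto_timeMap_right {F T : ℝ → ℝ} {a b K : ℝ} (hab : a < b) (hK : 0 < K)
    (hneg : ∀ y ∈ Ioo a b, F y < 0) (hbound : ∀ y ∈ Ioo a b, -F y ≤ K * (b - y))
    (hT : ∀ y ∈ Ioo a b, HasDerivAt T (F y)⁻¹ y) :
    Tendsto T (𝓝[<] b) atBot := by
  have hmem : ∀ y ∈ Ioo (-b) (-a), -y ∈ Ioo a b := fun y hy =>
    ⟨by linarith [hy.2], by linarith [hy.1]⟩
  have h : Tendsto (fun y => -T (-y)) (𝓝[>] (-b)) atTop := by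
    refine tendsto_timeMap_left (F := fun y => F (-y)) (neg_lt_neg hab) hK
      (fun y hy => hneg _ (hmem y hy)) (fun y hy => ?_) fun y hy => ?_
    · simpa [add_comm] using hbound _ (hmem y hy)
    · simpa using ((hT _ (hmem y hy)).comp y (hasDerivAt_neg y)).fun_neg
  have hcomp := tendsto_neg_atTop_atBot.comp (h.comp (tendsto_neg_nhdsLT (a := b)))
  simpa [Function.comp_def] using hcomp

/-- A solution of `z' = F(z)` runs through the time map at unit speed. -/
theorem timeMap_comp_eq {F T z : ℝ → ℝ} {s : Set ℝ} (hne : ∀ y ∈ s, F y ≠ 0)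
    (hT : ∀ y ∈ s, HasDerivAt T (F y)⁻¹ y) (hzs : ∀ ξ, z ξ ∈ s)
    (hz : ∀ ξ, HasDerivAt z (F (z ξ)) ξ) (ξ : ℝ) : T (z ξ) = ξ + T (z 0) := by
  have hderiv : ∀ t, HasDerivAt (fun t => T (z t) - t) 0 t := fun t => by
    have h := ((hT _ (hzs t)).comp t (hz t)).sub (hasDerivAt_id t)
    rw [inv_mul_cancel₀ (hne _ (hzs t)), sub_self] at h
    exact h
  have h := is_const_of_deriv_eq_zero (fun t => (hderiv t).differentiableAt)
    (fun t => (hderiv t).deriv) ξ 0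
  simp only [sub_zero] at h
  linarith

/-- A time map that is strictly decreasing from `(a, b)` onto `ℝ` has a decreasing connection
as its inverse. -/
theorem exists_isDecreasingConnection_of_timeMap {F T : ℝ → ℝ} {a b : ℝ} (hab : a < b)
    (hF : ContinuousOn F (Ioo a b)) (hne : ∀ y ∈ Ioo a b, F y ≠ 0)
    (hT : ∀ y ∈ Ioo a b, HasDerivAt T (F y)⁻¹ y) (hanti : StrictAntiOn T (Ioo a b))
    (hsurj : SurjOn T (Ioo a b) univ) : ∃ z, IsDecreasingConnection F a b z := by
  choose z hzs hTz using fun ξ => hsurj (mem_univ ξ)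
  have hz_anti : StrictAnti z := fun s t hst => by
    rwa [← hanti.lt_iff_gt (hzs s) (hzs t), hTz, hTz]
  have hrange : range z = Ioo a b :=
    (range_subset_iff.2 hzs).antisymm fun y hy =>
      ⟨T y, hanti.injOn (hzs _) hy (hTz _)⟩
  have hz_cont : Continuous z := by
    refine continuous_iff_continuousAt.2 fun ξ => ?_
    have hneg : ContinuousAt (fun t => -z t) ξ := by
      refine continuousAt_of_monotoneOn_of_image_mem_nhds (s := univ)
        (hz_anti.antitone.neg.monotoneOn _) univ_mem ?_
      have himage : (fun t => -z t) '' univ = Ioo (-b) (-a) := by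
        rw [image_univ, ← image_neg_Ioo, ← hrange, ← range_comp]
        rfl
      rw [himage]
      exact Ioo_mem_nhds (neg_lt_neg (hzs ξ).2) (neg_lt_neg (hzs ξ).1)
    simpa only [neg_neg] using hneg.fun_neg
  have hz_deriv : ∀ ξ, HasDerivAt z (F (z ξ)) ξ := fun ξ => by
    have h := (hT _ (hzs ξ)).of_local_left_inverse hz_cont.continuousAt
      (inv_ne_zero (hne _ (hzs ξ))) (Eventually.of_forall hTz)
    rwa [inv_inv] at h
  have hderiv : ∀ ξ, deriv z ξ = F (z ξ) := fun ξ => (hz_deriv ξ).deriv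
  refine ⟨z, contDiff_one_iff_deriv.2 ⟨fun ξ => (hz_deriv ξ).differentiableAt, ?_⟩,
    hz_anti, hzs, hderiv, ?_, ?_⟩
  · rw [funext hderiv]
    exact hF.comp_continuous hz_cont hzs
  · exact tendsto_atBot_isLUB hz_anti.antitone (hrange ▸ isLUB_Ioo hab)
  · exact tendsto_atTop_isGLB hz_anti.antitone (hrange ▸ isGLB_Ioo hab)

/-- Let `a < b` and let `F` be `C¹` on an open interval containing `[a,b]`, with
`F(a) = F(b) = 0` and `F < 0` on `(a,b)`.  Then there exists a `C¹`, strictly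
decreasing solution `z : ℝ → ℝ` of `z' = F(z)` with values in `(a,b)`,
`z → b` as `ξ → -∞` and `z → a` as `ξ → +∞`; and this solution is unique up to a
shift of the argument. -/
theorem stmt_5 (a b p q : ℝ) (hab : a < b) (hsub : Set.Icc a b ⊆ Set.Ioo p q)
    (F : ℝ → ℝ) (hF : ContDiffOn ℝ 1 F (Set.Ioo p q))
    (hFa : F a = 0) (hFb : F b = 0) (hneg : ∀ z ∈ Set.Ioo a b, F z < 0) :
    (∃ z : ℝ → ℝ, IsDecreasingConnection F a b z) ∧
    (∀ z₁ z₂ : ℝ → ℝ, IsDecreasingConnection F a b z₁ →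
      IsDecreasingConnection F a b z₂ →
      ∃ ξ₀ : ℝ, ∀ ξ, z₂ ξ = z₁ (ξ + ξ₀)) := by
  have hne : ∀ y ∈ Ioo a b, F y ≠ 0 := fun y hy => (hneg y hy).ne
  have hcont : ContinuousOn F (Ioo a b) :=
    hF.continuousOn.mono (Ioo_subset_Icc_self.trans hsub)
  obtain ⟨T, hT⟩ := exists_hasDerivAt_inv hab hcont hne
  have hTcont : ContinuousOn T (Ioo a b) := fun y hy =>
    (hT y hy).continuousAt.continuousWithinAt
  have hanti : StrictAntiOn T (Ioo a b) :=
    strictAntiOn_of_hasDerivWithinAt_neg (convex_Ioo a b) hTcont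
      (fun y hy => (hT y (interior_subset hy)).hasDerivWithinAt)
      fun y hy => inv_lt_zero.2 (hneg y (interior_subset hy))
  refine ⟨?_, ?_⟩
  · obtain ⟨L, hL⟩ := (hF.mono hsub).exists_lipschitzOnWith one_ne_zero (convex_Icc a b)
      isCompact_Icc
    have hK : (0 : ℝ) < L + 1 := by positivity
    have hleft : ∀ y ∈ Ioo a b, -F y ≤ (L + 1) * (y - a) := fun y hy => by
      have h := hL.dist_le_mul y (Ioo_subset_Icc_self hy) a (left_mem_Icc.2 hab.le)
      rw [Real.dist_eq, Real.dist_eq, hFa, sub_zero, abs_of_pos (sub_pos.2 hy.1)] at h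
      linarith [neg_le_abs (F y), hy.1]
    have hright : ∀ y ∈ Ioo a b, -F y ≤ (L + 1) * (b - y) := fun y hy => by
      have h := hL.dist_le_mul y (Ioo_subset_Icc_self hy) b (right_mem_Icc.2 hab.le)
      rw [Real.dist_eq, Real.dist_eq, hFb, sub_zero, abs_sub_comm,
        abs_of_pos (sub_pos.2 hy.2)] at h
      linarith [neg_le_abs (F y), hy.2]
    refine exists_isDecreasingConnection_of_timeMap hab hcont hne hT hanti ?_
    exact isPreconnected_Ioo.intermediate_value_Iii
      (le_principal_iff.2 (Ioo_mem_nhdsLT hab)) (le_principal_iff.2 (Ioo_mem_nhdsGT hab))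
      hTcont (tendsto_timeMap_right hab hK hneg hright hT)
      (tendsto_timeMap_left hab hK hneg hleft hT)
  · rintro z₁ z₂ ⟨hz₁, -, hz₁s, hz₁d, -⟩ ⟨hz₂, -, hz₂s, hz₂d, -⟩
    have h₁ := timeMap_comp_eq hne hT hz₁s fun ξ =>
      hz₁d ξ ▸ (hz₁.differentiable one_ne_zero ξ).hasDerivAt
    have h₂ := timeMap_comp_eq hne hT hz₂s fun ξ =>
      hz₂d ξ ▸ (hz₂.differentiable one_ne_zero ξ).hasDerivAt
    refine ⟨T (z₂ 0) - T (z₁ 0), fun ξ => hanti.injOn (hz₂s _) (hz₁s _) ?_⟩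
    rw [h₁, h₂]
    ring
end

section
/- Let ω > 0 and let 0 < v⁺ < 1 < v⁻ be prescribed. Define c = (ω/2)(1-v⁺)²/(v⁻ - v⁺) > 0 and K₀ = -c v⁻. Then there exists a continuously differentiable, strictly decreasing function v : ℝ → (0,∞) with v⁺ < v(ξ) < v⁻ for all ξ, lim_{ξ→-∞} v(ξ) = v⁻, lim_{ξ→+∞} v(ξ) = v⁺, and such that d/dξ [A(v(ξ))] = K₀ + c v(ξ) - B(v(ξ)) for all ξ ∈ ℝ. Consequently φ(x,t) := v(x + c(T-t)) is a traveling wave solution, with positive wave speed c, of the equation ∂ₜφ + ∂ₓₓ A(φ) + ∂ₓ B(φ) = 0. -/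
/-- The function `A` of the simple model. -/
noncomputable def Asimple (φ : ℝ) : ℝ := if φ ≤ 1 then φ / 2 else 1 - 1 / (2 * φ)

/-- The function `B` of the simple model. -/
noncomputable def Bsimple (ω φ : ℝ) : ℝ := if φ ≤ 1 then -(ω / 2) * (1 - φ) ^ 2 else 0

open Set Filter Topology in
/-- A scalar autonomous equation `w' = f w` with `f` continuous and positive on `(a, b)` and at most
linear at both end points has a global solution increasing from `a` to `b`. -/
theorem exists_heteroclinic_solution {f : ℝ → ℝ} {a b La Lb : ℝ} (hab : a < b)
    (hLa : 0 < La) (hLb : 0 < Lb) (hf : ContinuousOn f (Ioo a b))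
    (hpos : ∀ u ∈ Ioo a b, 0 < f u) (hfa : ∀ u ∈ Ioo a b, f u ≤ La * (u - a))
    (hfb : ∀ u ∈ Ioo a b, f u ≤ Lb * (b - u)) :
    ∃ w : ℝ → ℝ, (∀ ξ, w ξ ∈ Ioo a b) ∧ (∀ ξ, HasDerivAt w (f (w ξ)) ξ) ∧
      Tendsto w atBot (𝓝 a) ∧ Tendsto w atTop (𝓝 b) := by
  obtain ⟨m, hm⟩ : (Ioo a b).Nonempty := nonempty_Ioo.2 hab
  have hcont : ContinuousOn (fun u => (f u)⁻¹) (Ioo a b) :=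
    hf.inv₀ fun u hu => (hpos u hu).ne'
  set H : ℝ → ℝ := fun u => ∫ s in m..u, (f s)⁻¹ with hH
  have hHm : H m = 0 := by simp [hH]
  have hHd : ∀ u ∈ Ioo a b, HasDerivAt H (f u)⁻¹ u := fun u hu =>
    intervalIntegral.integral_hasDerivAt_right
      ((hcont.mono (OrdConnected.uIcc_subset ordConnected_Ioo hm hu)).intervalIntegrable)
      (hcont.stronglyMeasurableAtFilter isOpen_Ioo u hu)
      (hcont.continuousAt (isOpen_Ioo.mem_nhds hu))
  have hHc : ContinuousOn H (Ioo a b) := fun u hu => (hHd u hu).continuousAt.continuousWithinAt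
  have hmono : StrictMonoOn H (Ioo a b) := by
    refine strictMonoOn_of_deriv_pos (convex_Ioo a b) hHc fun u hu => ?_
    rw [interior_Ioo] at hu
    rw [(hHd u hu).deriv]
    exact inv_pos.2 (hpos u hu)
  have hupper : MonotoneOn (fun u => H u + Lb⁻¹ * Real.log (b - u)) (Ioo a b) := by
    have hd : ∀ u ∈ Ioo a b, HasDerivAt (fun u => H u + Lb⁻¹ * Real.log (b - u))
        ((f u)⁻¹ + Lb⁻¹ * (-1 / (b - u))) u := fun u hu =>
      (hHd u hu).add ((((hasDerivAt_id u).const_sub b).log (sub_pos.2 hu.2).ne').const_mul _)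
    refine monotoneOn_of_deriv_nonneg (convex_Ioo a b)
      (fun u hu => (hd u hu).continuousAt.continuousWithinAt)
      (fun u hu => (hd u (interior_subset hu)).differentiableAt.differentiableWithinAt)
      fun u hu => ?_
    rw [interior_Ioo] at hu
    rw [(hd u hu).deriv]
    have h := inv_anti₀ (hpos u hu) (hfb u hu)
    rw [mul_inv] at h
    rw [neg_div, one_div]
    linarith
  have hlower : MonotoneOn (fun u => H u - La⁻¹ * Real.log (u - a)) (Ioo a b) := by
    have hd : ∀ u ∈ Ioo a b, HasDerivAt (fun u => H u - La⁻¹ * Real.log (u - a))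
        ((f u)⁻¹ - La⁻¹ * (1 / (u - a))) u := fun u hu =>
      (hHd u hu).sub ((((hasDerivAt_id u).sub_const a).log (sub_pos.2 hu.1).ne').const_mul _)
    refine monotoneOn_of_deriv_nonneg (convex_Ioo a b)
      (fun u hu => (hd u hu).continuousAt.continuousWithinAt)
      (fun u hu => (hd u (interior_subset hu)).differentiableAt.differentiableWithinAt)
      fun u hu => ?_
    rw [interior_Ioo] at hu
    rw [(hd u hu).deriv]
    have h := inv_anti₀ (hpos u hu) (hfa u hu)
    rw [mul_inv] at h
    rw [one_div]
    linarith
  have hbm : 0 < b - m := sub_pos.2 hm.2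
  have hma : 0 < m - a := sub_pos.2 hm.1
  have hsurj : ∀ y, ∃ u ∈ Ioo a b, H u = y := by
    intro y
    have hexp : ∀ L : ℝ, 0 < L → Real.exp (-(L * |y|)) ≤ 1 := fun L hL =>
      Real.exp_le_one_iff.2 (neg_nonpos.2 (by positivity))
    have h₁ : ∃ u ∈ Ioo a b, H u ≤ y := by
      have he := Real.exp_pos (-(La * |y|))
      have hle : (m - a) * Real.exp (-(La * |y|)) ≤ m - a :=
        mul_le_of_le_one_right hma.le (hexp La hLa)
      have hu : a + (m - a) * Real.exp (-(La * |y|)) ∈ Ioo a b :=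
        ⟨by linarith [mul_pos hma he], by linarith [hm.2]⟩
      refine ⟨_, hu, ?_⟩
      have h := hlower hu hm (by linarith)
      simp only [hHm, add_sub_cancel_left, Real.log_mul hma.ne' he.ne', Real.log_exp] at h
      have hc : La⁻¹ * (La * |y|) = |y| := inv_mul_cancel_left₀ hLa.ne' _
      linarith [neg_abs_le y]
    have h₂ : ∃ u ∈ Ioo a b, y ≤ H u := by
      have he := Real.exp_pos (-(Lb * |y|))
      have hle : (b - m) * Real.exp (-(Lb * |y|)) ≤ b - m :=
        mul_le_of_le_one_right hbm.le (hexp Lb hLb)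
      have hu : b - (b - m) * Real.exp (-(Lb * |y|)) ∈ Ioo a b :=
        ⟨by linarith [hm.1], by linarith [mul_pos hbm he]⟩
      refine ⟨_, hu, ?_⟩
      have h := hupper hm hu (by linarith)
      simp only [hHm, sub_sub_cancel, Real.log_mul hbm.ne' he.ne', Real.log_exp] at h
      have hc : Lb⁻¹ * (Lb * |y|) = |y| := inv_mul_cancel_left₀ hLb.ne' _
      linarith [le_abs_self y]
    obtain ⟨u₁, hu₁, hy₁⟩ := h₁
    obtain ⟨u₂, hu₂, hy₂⟩ := h₂
    exact isPreconnected_Ioo.intermediate_value hu₁ hu₂ hHc ⟨hy₁, hy₂⟩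
  choose w hw hHw using hsurj
  have hwm : Monotone w := fun x y hxy => by
    rw [← hmono.le_iff_le (hw x) (hw y), hHw, hHw]
    exact hxy
  have hrange : range w = Ioo a b := by
    refine Subset.antisymm (range_subset_iff.2 hw) fun u hu => ⟨H u, ?_⟩
    exact hmono.injOn (hw _) hu (hHw _)
  refine ⟨w, hw, fun ξ => ?_, ?_, ?_⟩
  · have hwc : ContinuousAt w ξ := by
      refine continuousAt_of_monotoneOn_of_image_mem_nhds (hwm.monotoneOn univ) univ_mem ?_
      rw [image_univ, hrange]
      exact isOpen_Ioo.mem_nhds (hw ξ)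
    have h := HasDerivAt.of_local_left_inverse hwc (hHd _ (hw ξ))
      (inv_ne_zero (hpos _ (hw ξ)).ne') (Eventually.of_forall hHw)
    rwa [inv_inv] at h
  · exact tendsto_atBot_isGLB hwm (hrange ▸ isGLB_Ioo hab)
  · exact tendsto_atTop_isLUB hwm (hrange ▸ isLUB_Ioo hab)

open Set Filter Topology in
/-- Differentiability of a function glued at `a` from two pieces with matching values and
derivatives. -/
theorem hasDerivAt_ite_le {f g : ℝ → ℝ} {a d x : ℝ} (hf : x ≤ a → HasDerivAt f d x)
    (hg : a ≤ x → HasDerivAt g d x) (hfg : f a = g a) :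
    HasDerivAt (fun y => if y ≤ a then f y else g y) d x := by
  rcases lt_trichotomy x a with h | rfl | h
  · refine (hf h.le).congr_of_eventuallyEq ?_
    filter_upwards [Iio_mem_nhds h] with y hy
    exact if_pos (le_of_lt hy)
  · rw [← hasDerivWithinAt_univ, ← Iic_union_Ici (a := x)]
    refine ((hf le_rfl).hasDerivWithinAt.congr (fun y hy => if_pos (mem_Iic.1 hy))
      (if_pos le_rfl)).union
      ((hg le_rfl).hasDerivWithinAt.congr (fun y hy => ?_) ((if_pos le_rfl).trans hfg))
    rcases eq_or_lt_of_le (mem_Ici.1 hy) with rfl | hlt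
    · exact (if_pos le_rfl).trans hfg
    · exact if_neg hlt.not_ge
  · refine (hg h.le).congr_of_eventuallyEq ?_
    filter_upwards [Ioi_mem_nhds h] with y hy
    exact if_neg (not_le.2 hy)

theorem hasDerivAt_Asimple (u : ℝ) : HasDerivAt Asimple (2 * max 1 u ^ 2)⁻¹ u := by
  refine hasDerivAt_ite_le (f := fun φ => φ / 2) (g := fun φ => 1 - 1 / (2 * φ))
    (fun h => ?_) (fun h => ?_) (by norm_num)
  · rw [max_eq_left h]
    exact ((hasDerivAt_id u).div_const 2).congr_deriv (by norm_num)
  · rw [max_eq_right h]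
    have hu : u ≠ 0 := by linarith
    refine ((((hasDerivAt_id u).const_mul 2).fun_inv (by simpa using hu)).const_sub 1
      |>.congr_deriv ?_).congr_of_eventuallyEq (Filter.Eventually.of_forall fun y => ?_)
    · simp only [id]
      field_simp
    · simp

theorem hasDerivAt_Bsimple (ω u : ℝ) : HasDerivAt (Bsimple ω) (ω * max (1 - u) 0) u := by
  refine hasDerivAt_ite_le (f := fun φ => -(ω / 2) * (1 - φ) ^ 2) (g := fun _ => 0)
    (fun h => ?_) (fun h => ?_) (by norm_num)
  · rw [max_eq_left (sub_nonneg.2 h)]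
    exact ((((hasDerivAt_id u).const_sub 1).pow 2).const_mul (-(ω / 2))).congr_deriv
      (by simp only [id]; ring)
  · rw [max_eq_right (sub_nonpos.2 h), mul_zero]
    exact hasDerivAt_const u 0

/-- Let `ω > 0` and `0 < v⁺ < 1 < v⁻`.  Define `c = (ω/2)(1-v⁺)²/(v⁻-v⁺)` and
`K₀ = -c v⁻`.  Then there exists a `C¹`, strictly decreasing function
`v : ℝ → (0,∞)` with `v⁺ < v < v⁻`, `v → v⁻` at `-∞`, `v → v⁺` at `+∞`, and
`(A(v(ξ)))' = K₀ + c v(ξ) - B(v(ξ))` for all `ξ`.  Consequently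
`φ(x,t) := v(x + c(T-t))` is a traveling wave solution with positive wave speed
`c` of `∂ₜφ + ∂ₓₓ A(φ) + ∂ₓ B(φ) = 0`. -/
theorem stmt_6 (ω T vp vm : ℝ) (hω : 0 < ω) (h0 : 0 < vp) (h1 : vp < 1) (h2 : 1 < vm) :
    let c : ℝ := ω / 2 * (1 - vp) ^ 2 / (vm - vp)
    let K₀ : ℝ := -c * vm
    0 < c ∧
    ∃ v : ℝ → ℝ, ContDiff ℝ 1 v ∧ StrictAnti v ∧ (∀ ξ, 0 < v ξ) ∧
      (∀ ξ, vp < v ξ ∧ v ξ < vm) ∧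
      Filter.Tendsto v Filter.atBot (nhds vm) ∧
      Filter.Tendsto v Filter.atTop (nhds vp) ∧
      (∀ ξ, deriv (fun ξ' => Asimple (v ξ')) ξ = K₀ + c * v ξ - Bsimple ω (v ξ)) ∧
      (∀ x t : ℝ,
        deriv (fun s => v (x + c * (T - s))) t
          + deriv (deriv (fun y => Asimple (v (y + c * (T - t))))) x
          + deriv (fun y => Bsimple ω (v (y + c * (T - t)))) x = 0) := by
  intro c K₀
  have hd : 0 < vm - vp := by linarith
  have hq : 0 < 1 - vp := by linarith
  have hc : 0 < c := by positivity
  have hcd : c * (vm - vp) = ω / 2 * (1 - vp) ^ 2 := div_mul_cancel₀ _ hd.ne'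
  have hclt : c < ω / 2 * (1 - vp) := by
    refine (div_lt_iff₀ hd).2 ?_
    have : 0 < ω / 2 * (1 - vp) * (vm - 1) := by
      have : 0 < vm - 1 := by linarith
      positivity
    nlinarith
  have hBc : Continuous (Bsimple ω) :=
    continuous_iff_continuousAt.2 fun u => (hasDerivAt_Bsimple ω u).continuousAt
  set f : ℝ → ℝ := fun u => 2 * max 1 u ^ 2 * (c * (vm - u) + Bsimple ω u) with hf
  have hfc : Continuous f := by fun_prop
  have hf_left : ∀ u ≤ 1, f u = 2 * (u - vp) * (ω / 2 * (2 - vp - u) - c) := by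
    intro u hu
    simp only [hf, max_eq_left hu, Bsimple, if_pos hu]
    linear_combination 2 * hcd
  have hf_right : ∀ u, 1 < u → f u = 2 * u ^ 2 * (c * (vm - u)) := by
    intro u hu
    simp only [hf, max_eq_right hu.le, Bsimple, if_neg hu.not_ge, add_zero]
  have hpos : ∀ u ∈ Set.Ioo vp vm, 0 < f u := by
    rintro u ⟨hu₁, hu₂⟩
    rcases le_or_gt u 1 with h | h
    · rw [hf_left u h]
      have : 0 < ω / 2 * (2 - vp - u) - c := by nlinarith
      have : 0 < u - vp := by linarith
      positivity
    · rw [hf_right u h]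
      have : 0 < vm - u := by linarith
      positivity
  have hfb : ∀ u ∈ Set.Ioo vp vm, f u ≤ 2 * vm ^ 2 * c * (vm - u) := by
    rintro u ⟨hu₁, hu₂⟩
    have hX : 0 ≤ c * (vm - u) := mul_nonneg hc.le (by linarith)
    have hB : Bsimple ω u ≤ 0 := by
      unfold Bsimple
      split_ifs
      · nlinarith [mul_nonneg hω.le (sq_nonneg (1 - u))]
      · exact le_rfl
    have hmax : max 1 u ≤ vm := max_le h2.le hu₂.le
    calc f u ≤ 2 * max 1 u ^ 2 * (c * (vm - u)) :=
          mul_le_mul_of_nonneg_left (by linarith) (by positivity)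
      _ ≤ 2 * vm ^ 2 * (c * (vm - u)) := by gcongr
      _ = 2 * vm ^ 2 * c * (vm - u) := by ring
  have hfa : ∀ u ∈ Set.Ioo vp vm,
      f u ≤ (2 * ω + 2 * vm ^ 2 * c * (vm - vp) / (1 - vp)) * (u - vp) := by
    rintro u ⟨hu₁, hu₂⟩
    have hup : 0 < u - vp := by linarith
    have hQ : 0 < 2 * vm ^ 2 * c * (vm - vp) / (1 - vp) := by positivity
    rcases le_or_gt u 1 with h | h
    · rw [hf_left u h, mul_comm 2, mul_assoc, mul_comm (u - vp)]
      refine mul_le_mul_of_nonneg_right ?_ hup.le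
      nlinarith
    · calc f u ≤ 2 * vm ^ 2 * c * (vm - u) := hfb u ⟨hu₁, hu₂⟩
        _ ≤ 2 * vm ^ 2 * c * (vm - vp) := by gcongr
        _ = 2 * vm ^ 2 * c * (vm - vp) / (1 - vp) * (1 - vp) := (div_mul_cancel₀ _ hq.ne').symm
        _ ≤ 2 * vm ^ 2 * c * (vm - vp) / (1 - vp) * (u - vp) := by gcongr
        _ ≤ _ := mul_le_mul_of_nonneg_right (by linarith) hup.le
  obtain ⟨w, hw, hwd, hbot, htop⟩ := exists_heteroclinic_solution (f := f) (a := vp)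
    (b := vm) (La := 2 * ω + 2 * vm ^ 2 * c * (vm - vp) / (1 - vp)) (Lb := 2 * vm ^ 2 * c)
    (by linarith) (by positivity) (by positivity) hfc.continuousOn hpos hfa hfb
  have hvd : ∀ ξ, HasDerivAt (fun ξ => w (-ξ)) (-f (w (-ξ))) ξ := fun ξ =>
    ((hwd (-ξ)).comp ξ (hasDerivAt_neg ξ)).congr_deriv (mul_neg_one _)
  generalize hv : (fun ξ => w (-ξ)) = v at hvd
  have hwv : ∀ ξ, w (-ξ) = v ξ := fun ξ => congrFun hv ξ
  simp only [hwv] at hvd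
  have hmem : ∀ ξ, v ξ ∈ Set.Ioo vp vm := fun ξ => hwv ξ ▸ hw (-ξ)
  have hvc : Continuous v := continuous_iff_continuousAt.2 fun ξ => (hvd ξ).continuousAt
  have hA : ∀ ξ, HasDerivAt (fun y => Asimple (v y)) (K₀ + c * v ξ - Bsimple ω (v ξ)) ξ := by
    intro ξ
    refine ((hasDerivAt_Asimple (v ξ)).comp ξ (hvd ξ)).congr_deriv ?_
    have hM : (2 * max 1 (v ξ) ^ 2) ≠ 0 := by positivity
    rw [mul_neg, inv_mul_cancel_left₀ hM]
    simp only [K₀]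
    ring
  have hB : ∀ ξ, DifferentiableAt ℝ (fun y => Bsimple ω (v y)) ξ := fun ξ =>
    ((hasDerivAt_Bsimple ω (v ξ)).comp ξ (hvd ξ)).differentiableAt
  refine ⟨hc, v, ?_, ?_, fun ξ => h0.trans (hmem ξ).1, hmem, ?_, ?_, fun ξ => (hA ξ).deriv, ?_⟩
  · refine contDiff_one_iff_deriv.2 ⟨fun ξ => (hvd ξ).differentiableAt, ?_⟩
    rw [funext fun ξ => (hvd ξ).deriv]
    exact (hfc.comp hvc).neg
  · refine strictAnti_of_deriv_neg fun ξ => ?_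
    rw [(hvd ξ).deriv]
    exact neg_lt_zero.2 (hpos _ (hmem ξ))
  · rw [← hv]
    exact htop.comp Filter.tendsto_neg_atBot_atTop
  · rw [← hv]
    exact hbot.comp Filter.tendsto_neg_atTop_atBot
  · intro x t
    set s := c * (T - t)
    have hφt : HasDerivAt (fun r => v (x + c * (T - r))) (-f (v (x + s)) * (c * -1)) t :=
      (hvd (x + s)).comp t ((((hasDerivAt_id t).const_sub T).const_mul c).const_add x)
    have hAx : deriv (fun y => Asimple (v (y + s))) =
        fun y => K₀ + c * v (y + s) - Bsimple ω (v (y + s)) :=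
      funext fun y => ((hA (y + s)).comp_add_const y s).deriv
    have hBx : HasDerivAt (fun y => Bsimple ω (v (y + s)))
        (deriv (fun y => Bsimple ω (v y)) (x + s)) x :=
      (hB (x + s)).hasDerivAt.comp_add_const x s
    have hAxx : HasDerivAt (fun y => K₀ + c * v (y + s) - Bsimple ω (v (y + s)))
        (c * -f (v (x + s)) - deriv (fun y => Bsimple ω (v y)) (x + s)) x :=
      ((((hvd (x + s)).comp_add_const x s).const_mul c).const_add K₀).sub hBx
    rw [hφt.deriv, hAx, hBx.deriv, hAxx.deriv]
    ring
end

section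
/- Let ω > 0, c < 0 and K₀ ∈ ℝ. Then the function F is strictly decreasing on (0,1): F′(z) < 0 for every z ∈ (0,1) (in particular F(0) = K₀ + ω/2 > K₀ + c = F(1/2)), and F(z) → -∞ as z → 1⁻. Consequently there exist NO points z₁, z₂ with 0 < z₁ < 1/2 < z₂ < 1 such that F(z₁) = F(z₂) = 0, F′(z₁) > 0 and F′(z₂) < 0; i.e. no monotonically increasing traveling wave profile with negative wave speed exists for the simple model. -/
lemma Fsimple_of_le_half (ω c K₀ : ℝ) {z : ℝ} (hz : z ≤ 1 / 2) :
    Fsimple ω c K₀ z = K₀ + 2 * c * z + ω / 2 * (1 - 2 * z) ^ 2 := by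
  rcases hz.lt_or_eq with h | rfl
  · exact if_pos h
  · norm_num [Fsimple]
    ring

lemma Fsimple_of_half_le (ω c K₀ : ℝ) {z : ℝ} (hz : 1 / 2 ≤ z) :
    Fsimple ω c K₀ z = K₀ + c / (2 * (1 - z)) :=
  if_neg hz.not_gt

lemma hasDerivAt_left_branch (ω c K₀ z : ℝ) :
    HasDerivAt (fun x : ℝ => K₀ + 2 * c * x + ω / 2 * (1 - 2 * x) ^ 2)
      (2 * c - 2 * ω * (1 - 2 * z)) z := by
  have h : HasDerivAt (fun x : ℝ => 1 - 2 * x) (-(2 * 1)) z :=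
    ((hasDerivAt_id' z).const_mul 2).const_sub 1
  refine ((((hasDerivAt_id' z).const_mul (2 * c)).const_add K₀).fun_add
    ((h.fun_pow 2).const_mul (ω / 2))).congr_deriv ?_
  push_cast
  ring

lemma hasDerivAt_right_branch (c K₀ : ℝ) {z : ℝ} (hz : z < 1) :
    HasDerivAt (fun x : ℝ => K₀ + c / (2 * (1 - x))) (c / (2 * (1 - z) ^ 2)) z := by
  have hz' : 1 - z ≠ 0 := (sub_pos.2 hz).ne'
  have h : HasDerivAt (fun x : ℝ => 2 * (1 - x)) (2 * (-1)) z :=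
    ((hasDerivAt_id' z).const_sub 1).const_mul 2
  refine (((hasDerivAt_const z c).fun_div h
    (mul_ne_zero two_ne_zero hz')).const_add K₀).congr_deriv ?_
  field_simp
  ring

lemma hasDerivAt_Fsimple_of_lt_half (ω c K₀ : ℝ) {z : ℝ} (hz : z < 1 / 2) :
    HasDerivAt (Fsimple ω c K₀) (2 * c - 2 * ω * (1 - 2 * z)) z :=
  (hasDerivAt_left_branch ω c K₀ z).congr_of_eventuallyEq <| by
    filter_upwards [Iio_mem_nhds hz] with x hx using Fsimple_of_le_half ω c K₀ (le_of_lt hx)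

lemma hasDerivAt_Fsimple_of_half_lt (ω c K₀ : ℝ) {z : ℝ} (hz : 1 / 2 < z) (hz1 : z < 1) :
    HasDerivAt (Fsimple ω c K₀) (c / (2 * (1 - z) ^ 2)) z :=
  (hasDerivAt_right_branch c K₀ hz1).congr_of_eventuallyEq <| by
    filter_upwards [Ioi_mem_nhds hz] with x hx using Fsimple_of_half_le ω c K₀ (le_of_lt hx)

lemma hasDerivAt_Fsimple_half (ω c K₀ : ℝ) :
    HasDerivAt (Fsimple ω c K₀) (2 * c) (1 / 2) := by
  have hl : HasDerivWithinAt (Fsimple ω c K₀) (2 * c) (Set.Iic (1 / 2)) (1 / 2) := by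
    have h := (hasDerivAt_left_branch ω c K₀ (1 / 2)).hasDerivWithinAt (s := Set.Iic (1 / 2))
    norm_num only [mul_zero, sub_zero] at h ⊢
    refine h.congr (fun x hx => ?_) ?_ <;> apply Fsimple_of_le_half
    · exact hx
    · exact le_rfl
  have hr : HasDerivWithinAt (Fsimple ω c K₀) (2 * c) (Set.Ici (1 / 2)) (1 / 2) := by
    have h := (hasDerivAt_right_branch c K₀ (z := 1 / 2) (by norm_num)).hasDerivWithinAt
      (s := Set.Ici (1 / 2))
    rw [show c / (2 * (1 - 1 / 2) ^ 2) = 2 * c by ring] at h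
    exact h.congr (fun x hx => Fsimple_of_half_le ω c K₀ hx) (Fsimple_of_half_le ω c K₀ le_rfl)
  simpa [Set.Iic_union_Ici] using hl.union hr

lemma deriv_Fsimple_neg {ω c : ℝ} (K₀ : ℝ) (hω : 0 < ω) (hc : c < 0) {z : ℝ} (hz : z < 1) :
    deriv (Fsimple ω c K₀) z < 0 := by
  rcases lt_trichotomy z (1 / 2) with h | rfl | h
  · rw [(hasDerivAt_Fsimple_of_lt_half ω c K₀ h).deriv]
    have : 0 < ω * (1 - 2 * z) := mul_pos hω (by linarith)
    linarith
  · rw [(hasDerivAt_Fsimple_half ω c K₀).deriv]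
    linarith
  · rw [(hasDerivAt_Fsimple_of_half_lt ω c K₀ h hz).deriv]
    have : 0 < 1 - z := sub_pos.2 hz
    exact div_neg_of_neg_of_pos hc (by positivity)

lemma tendsto_Fsimple_atBot (ω K₀ : ℝ) {c : ℝ} (hc : c < 0) :
    Filter.Tendsto (Fsimple ω c K₀) (nhdsWithin 1 (Set.Iio 1)) Filter.atBot := by
  have h0 : Filter.Tendsto (fun x : ℝ => 2 * (1 - x)) (nhdsWithin 1 (Set.Iio 1))
      (nhdsWithin 0 (Set.Ioi 0)) := by
    refine tendsto_nhdsWithin_iff.2 ⟨?_, ?_⟩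
    · have : ContinuousAt (fun x : ℝ => 2 * (1 - x)) 1 := by fun_prop
      simpa using this.tendsto.mono_left nhdsWithin_le_nhds
    · filter_upwards [self_mem_nhdsWithin] with x hx
      exact mul_pos (two_pos : (0 : ℝ) < 2) (sub_pos.2 hx)
  have h1 := Filter.tendsto_atBot_add_const_left _ K₀
    ((Filter.tendsto_const_mul_atBot_of_neg hc).2 h0.inv_tendsto_nhdsGT_zero)
  refine h1.congr' ?_
  filter_upwards [mem_nhdsWithin_of_mem_nhds (Ioi_mem_nhds (by norm_num : (1 / 2 : ℝ) < 1))]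
    with x hx
  rw [Fsimple_of_half_le ω c K₀ (le_of_lt hx), div_eq_mul_inv, Pi.inv_apply]

/-- Let `ω > 0`, `c < 0` and `K₀ ∈ ℝ`.  Then `F′(z) < 0` for every `z ∈ (0,1)` (in
particular `F(0) = K₀ + ω/2 > K₀ + c = F(1/2)`), and `F(z) → -∞` as `z → 1⁻`.
Consequently there are no points `0 < z₁ < 1/2 < z₂ < 1` with
`F(z₁) = F(z₂) = 0`, `F′(z₁) > 0` and `F′(z₂) < 0`; i.e. no monotonically
increasing traveling wave profile with negative wave speed exists for the simple
model. -/
theorem stmt_11 (ω c K₀ : ℝ) (hω : 0 < ω) (hc : c < 0) :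
    (∀ z ∈ Set.Ioo (0 : ℝ) 1, deriv (Fsimple ω c K₀) z < 0) ∧
    Fsimple ω c K₀ 0 = K₀ + ω / 2 ∧
    Fsimple ω c K₀ (1 / 2) = K₀ + c ∧
    K₀ + c < K₀ + ω / 2 ∧
    Filter.Tendsto (Fsimple ω c K₀) (nhdsWithin 1 (Set.Iio 1)) Filter.atBot ∧
    ¬∃ z₁ z₂ : ℝ, 0 < z₁ ∧ z₁ < 1 / 2 ∧ 1 / 2 < z₂ ∧ z₂ < 1 ∧
      Fsimple ω c K₀ z₁ = 0 ∧ Fsimple ω c K₀ z₂ = 0 ∧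
      0 < deriv (Fsimple ω c K₀) z₁ ∧ deriv (Fsimple ω c K₀) z₂ < 0 := by
  refine ⟨fun z hz => deriv_Fsimple_neg K₀ hω hc hz.2, ?_, ?_, by linarith,
    tendsto_Fsimple_atBot ω K₀ hc, ?_⟩
  · norm_num [Fsimple]
  · norm_num [Fsimple]
  · rintro ⟨z₁, z₂, -, h1, -, -, -, -, hd, -⟩
    exact hd.not_gt (deriv_Fsimple_neg K₀ hω hc (by linarith))
end

section
/- Let m > 1, ω > 0, α, β ∈ ℝ, and let V : ℝ × [0,T] → ℝ be a smooth function with ∂ₓV(x,t) > 0 and ∂ₓₓV(x,t) < 0 everywhere. Suppose the function φ(x,t) := -(1/ω)∂ₓₓV(x,t)/∂ₓV(x,t) is positive and V satisfies ∂ₜV + (α² + (1/m)φ^{-m/(m-1)})∂ₓₓV + (β + ωφ^{-1/(m-1)})∂ₓV = 0. Then φ satisfies the equation ∂ₜφ + ∂ₓₓ( α²φ - ((m-1)/m)φ^{-1/(m-1)} ) + ∂ₓ( βφ - ωα²φ² + ((m-1)/m)ω φ^{(m-2)/(m-1)} ) = 0 at every point (x,t). -/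
section

open scoped ContDiff

theorem hasDerivAt_comp_prodMk_left {F : ℝ × ℝ → ℝ} {x t : ℝ} (hF : DifferentiableAt ℝ F (x, t)) :
    HasDerivAt (fun y => F (y, t)) (fderiv ℝ F (x, t) (1, 0)) x :=
  hF.hasFDerivAt.comp_hasDerivAt x ((hasDerivAt_id x).prodMk (hasDerivAt_const x t))

theorem hasDerivAt_comp_prodMk_right {F : ℝ × ℝ → ℝ} {x t : ℝ} (hF : DifferentiableAt ℝ F (x, t)) :
    HasDerivAt (fun s => F (x, s)) (fderiv ℝ F (x, t) (0, 1)) t :=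
  hF.hasFDerivAt.comp_hasDerivAt t ((hasDerivAt_const t x).prodMk (hasDerivAt_id t))

theorem ContDiff.deriv_prodMk_left {F : ℝ × ℝ → ℝ} (hF : ContDiff ℝ ∞ F) :
    ContDiff ℝ ∞ (fun p : ℝ × ℝ => deriv (fun y => F (y, p.2)) p.1) := by
  have h : (fun p : ℝ × ℝ => deriv (fun y => F (y, p.2)) p.1) = fun p => fderiv ℝ F p (1, 0) :=
    funext fun p => (hasDerivAt_comp_prodMk_left (hF.differentiable (by simp) _)).deriv
  rw [h]
  exact (hF.fderiv_right (by simp)).clm_apply contDiff_const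

/-- Mixed partial derivatives of a smooth function of two real variables commute. -/
theorem ContDiff.hasDerivAt_deriv_prodMk {F : ℝ × ℝ → ℝ} (hF : ContDiff ℝ ∞ F) (x t : ℝ) :
    HasDerivAt (fun s => deriv (fun y => F (y, s)) x)
      (deriv (fun y => deriv (fun s => F (y, s)) t) x) t := by
  have hdF : Differentiable ℝ F := hF.differentiable (by simp)
  have hd2 : DifferentiableAt ℝ (fderiv ℝ F) (x, t) :=
    (hF.fderiv_right (m := ∞) (by simp)).differentiable (by simp) _
  have hd : ∀ v : ℝ × ℝ, HasFDerivAt (fun p => fderiv ℝ F p v)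
      ((fderiv ℝ (fderiv ℝ F) (x, t)).flip v) (x, t) := fun v => by
    simpa using hd2.hasFDerivAt.clm_apply (hasFDerivAt_const v (x, t))
  have h1 : (fun s => deriv (fun y => F (y, s)) x) = fun s => fderiv ℝ F (x, s) (1, 0) :=
    funext fun s => (hasDerivAt_comp_prodMk_left (hdF _)).deriv
  have h2 : (fun y => deriv (fun s => F (y, s)) t) = fun y => fderiv ℝ F (y, t) (0, 1) :=
    funext fun y => (hasDerivAt_comp_prodMk_right (hdF _)).deriv
  have hsymm : IsSymmSndFDerivAt ℝ F (x, t) :=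
    hF.contDiffAt.isSymmSndFDerivAt (by
      simpa using (mod_cast le_top : ((2 : ℕ∞) : WithTop ℕ∞) ≤ ∞))
  have e1 := hasDerivAt_comp_prodMk_right (hd (1, 0)).differentiableAt
  have e2 := hasDerivAt_comp_prodMk_left (hd (0, 1)).differentiableAt
  rw [(hd _).fderiv] at e1 e2
  rw [h1, h2, e2.deriv]
  convert e1 using 1
  exact hsymm.eq _ _

end

/-- Let `m > 1`, `ω > 0`, `α β ∈ ℝ`, and let `V` be a smooth function with
`∂ₓV > 0`, `∂ₓₓV < 0` on `ℝ × [0,T]`.  Suppose `φ := -(1/ω)∂ₓₓV/∂ₓV` is positive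
and `V` satisfies
`∂ₜV + (α² + (1/m)φ^{-m/(m-1)})∂ₓₓV + (β + ωφ^{-1/(m-1)})∂ₓV = 0`.  Then `φ`
satisfies
`∂ₜφ + ∂ₓₓ(α²φ - ((m-1)/m)φ^{-1/(m-1)}) + ∂ₓ(βφ - ωα²φ² + ((m-1)/m)ω φ^{(m-2)/(m-1)}) = 0`
at every point `(x,t)`. -/
theorem stmt_13 (m ω α β T : ℝ) (hm : 1 < m) (hω : 0 < ω) (V φ : ℝ → ℝ → ℝ)
    (hsmooth : ContDiff ℝ (⊤ : ℕ∞) (fun p : ℝ × ℝ => V p.1 p.2))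
    (hVx : ∀ x t, t ∈ Set.Icc 0 T → 0 < deriv (fun y => V y t) x)
    (hVxx : ∀ x t, t ∈ Set.Icc 0 T → deriv (deriv (fun y => V y t)) x < 0)
    (hφ : ∀ x t, φ x t
        = -(1 / ω) * (deriv (deriv (fun y => V y t)) x / deriv (fun y => V y t) x))
    (hφpos : ∀ x t, t ∈ Set.Icc 0 T → 0 < φ x t)
    (hPDE : ∀ x t, t ∈ Set.Icc 0 T →
      deriv (fun s => V x s) t
        + (α ^ 2 + 1 / m * φ x t ^ (-(m / (m - 1)))) * deriv (deriv (fun y => V y t)) x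
        + (β + ω * φ x t ^ (-(1 / (m - 1)))) * deriv (fun y => V y t) x = 0) :
    ∀ x t, t ∈ Set.Icc 0 T →
      deriv (fun s => φ x s) t
        + deriv (deriv (fun y =>
            α ^ 2 * φ y t - (m - 1) / m * φ y t ^ (-(1 / (m - 1))))) x
        + deriv (fun y =>
            β * φ y t - ω * α ^ 2 * φ y t ^ 2
              + (m - 1) / m * ω * φ y t ^ ((m - 2) / (m - 1))) x = 0 := by
  intro x t ht
  have hm1 : m - 1 ≠ 0 := by linarith
  have hm0 : m ≠ 0 := by linarith
  have hω0 : ω ≠ 0 := hω.ne'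
  set v : ℝ → ℝ := fun z => deriv (fun y => V y t) z
  set q : ℝ → ℝ := fun z => φ z t
  set G : ℝ → ℝ := fun y =>
    ω * α ^ 2 * q y - β - ω * ((m - 1) / m) * q y ^ (-(1 / (m - 1))) with hG
  have hvpos : ∀ y, v y ≠ 0 := fun y => (hVx y t ht).ne'
  have hqpos : ∀ y, 0 < q y := fun y => hφpos y t ht
  have hqv : ∀ y, q y = -(1 / ω) * (deriv v y / v y) := fun y => hφ y t
  have hslice : ContDiff ℝ (⊤ : ℕ∞) (fun y : ℝ => (y, t)) := contDiff_id.prodMk contDiff_const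
  have hvs : ContDiff ℝ (⊤ : ℕ∞) v := hsmooth.deriv_prodMk_left.comp hslice
  have hv's : ContDiff ℝ (⊤ : ℕ∞) (deriv v) := (contDiff_infty_iff_deriv.1 hvs).2
  have hqs : ContDiff ℝ (⊤ : ℕ∞) q := by
    rw [funext hqv]
    exact contDiff_const.mul (hv's.div hvs hvpos)
  have hGs : ContDiff ℝ (⊤ : ℕ∞) G :=
    ((contDiff_const.mul hqs).sub contDiff_const).sub
      (contDiff_const.mul (hqs.rpow_const_of_ne fun y => (hqpos y).ne'))
  have hG's : ContDiff ℝ (⊤ : ℕ∞) (deriv G) := (contDiff_infty_iff_deriv.1 hGs).2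
  have dv : ∀ y, HasDerivAt v (deriv v y) y := fun y =>
    (hvs.differentiable (by simp) y).hasDerivAt
  have dv' : ∀ y, HasDerivAt (deriv v) (deriv (deriv v) y) y := fun y =>
    (hv's.differentiable (by simp) y).hasDerivAt
  have dG : ∀ y, HasDerivAt G (deriv G y) y := fun y =>
    (hGs.differentiable (by simp) y).hasDerivAt
  have dG' : ∀ y, HasDerivAt (deriv G) (deriv (deriv G) y) y := fun y =>
    (hG's.differentiable (by simp) y).hasDerivAt
  have hpow1 : ∀ y, q y ^ (-(1 / (m - 1))) = q y * q y ^ (-(m / (m - 1))) := fun y => by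
    rw [show -(1 / (m - 1)) = 1 + -(m / (m - 1)) by field_simp; ring,
      Real.rpow_add (hqpos y), Real.rpow_one]
  have hpow2 : ∀ y, q y ^ ((m - 2) / (m - 1)) = q y * q y ^ (-(1 / (m - 1))) := fun y => by
    rw [show (m - 2) / (m - 1) = 1 + -(1 / (m - 1)) by field_simp; ring,
      Real.rpow_add (hqpos y), Real.rpow_one]
  have hv'q : ∀ y, deriv v y = -ω * q y * v y := fun y => by
    have := hvpos y
    rw [hqv]
    field_simp
  have hVt : (fun y => deriv (fun s => V y s) t) = fun y => v y * G y := by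
    funext y
    have h : deriv (fun s => V y s) t + (α ^ 2 + 1 / m * q y ^ (-(m / (m - 1)))) * deriv v y
        + (β + ω * q y ^ (-(1 / (m - 1)))) * v y = 0 := hPDE y t ht
    rw [hv'q, hpow1] at h
    simp only [hG, hpow1]
    rw [show deriv (fun s => V y s) t = (α ^ 2 + 1 / m * q y ^ (-(m / (m - 1)))) * (ω * q y * v y)
      - (β + ω * (q y * q y ^ (-(m / (m - 1))))) * v y by linear_combination h]
    field_simp
    ring
  have hVtx : deriv (fun y => deriv (fun s => V y s) t)
      = fun y => deriv v y * G y + v y * deriv G y := by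
    rw [hVt]
    exact funext fun y => ((dv y).mul (dG y)).deriv
  have dvt : ∀ y, HasDerivAt (fun s => deriv (fun y => V y s) y)
      (deriv v y * G y + v y * deriv G y) t := fun y => by
    rw [← congrFun hVtx y]
    exact hsmooth.hasDerivAt_deriv_prodMk y t
  have dvxt : HasDerivAt (fun s => deriv (deriv (fun y => V y s)) x)
      (deriv (deriv v) x * G x + deriv v x * deriv G x
        + (deriv v x * deriv G x + v x * deriv (deriv G) x)) t := by
    have h := hsmooth.deriv_prodMk_left.hasDerivAt_deriv_prodMk x t
    have e : (fun y => deriv (fun s => deriv (fun z => V z s) y) t)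
        = fun y => deriv v y * G y + v y * deriv G y := funext fun y => (dvt y).deriv
    have e' : deriv (fun y => deriv v y * G y + v y * deriv G y) x = _ :=
      (((dv' x).mul (dG x)).add ((dv x).mul (dG' x))).deriv
    dsimp only at h
    rwa [e, e'] at h
  have e1 : deriv (fun s => φ x s) t
      = -(1 / ω) * (((deriv (deriv v) x * G x + deriv v x * deriv G x
        + (deriv v x * deriv G x + v x * deriv (deriv G) x)) * v x
        - deriv v x * (deriv v x * G x + v x * deriv G x)) / v x ^ 2) := by
    rw [funext fun s => hφ x s]
    exact ((dvxt.div (dvt x) (hvpos x)).const_mul (-(1 / ω))).deriv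
  have dq := ((dv' x).div (dv x) (hvpos x)).const_mul (-(1 / ω))
  have hA : (fun y => α ^ 2 * q y - (m - 1) / m * q y ^ (-(1 / (m - 1))))
      = fun y => 1 / ω * (G y + β) := by
    funext y
    simp only [hG]
    field_simp
    ring
  have hB : (fun y => β * q y - ω * α ^ 2 * q y ^ 2
      + (m - 1) / m * ω * q y ^ ((m - 2) / (m - 1)))
      = fun y => -((-(1 / ω) * (deriv v y / v y)) * G y) := by
    funext y
    rw [← hqv, hpow2]
    simp only [hG]
    ring
  have hA' : deriv (fun y => 1 / ω * (G y + β)) = fun y => 1 / ω * deriv G y :=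
    funext fun y => (((dG y).add_const β).const_mul (1 / ω)).deriv
  have hvx := hvpos x
  change deriv (fun s => φ x s) t
    + deriv (deriv (fun y => α ^ 2 * q y - (m - 1) / m * q y ^ (-(1 / (m - 1))))) x
    + deriv (fun y => β * q y - ω * α ^ 2 * q y ^ 2
      + (m - 1) / m * ω * q y ^ ((m - 2) / (m - 1))) x = 0
  have e2 := ((dG' x).const_mul (1 / ω)).deriv
  have e3 : deriv (fun y => -((-(1 / ω) * (deriv v y / v y)) * G y)) x
      = -(-(1 / ω) * ((deriv (deriv v) x * v x - deriv v x * deriv v x) / v x ^ 2) * G x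
        + -(1 / ω) * (deriv v x / v x) * deriv G x) :=
    (dq.mul (dG x)).neg.deriv
  rw [hA, hA', hB, e1, e2, e3]
  field_simp
  ring
end

section
/- Let m ≥ 2, ω > 0 and α, β ∈ ℝ. Then B is concave on (0,∞) (its second derivative satisfies B″(v) ≤ 0 for every v > 0, v ≠ 1). Consequently, for any constants c, K₀ ∈ ℝ the function G(v) = K₀ + cv - B(v) is convex on (0,∞), and there exist NO points 0 < v⁻ < v⁺ with G(v⁻) = G(v⁺) = 0 and G(v) > 0 for all v ∈ (v⁻, v⁺); i.e. no increasing traveling wave profile can be constructed when m ≥ 2. -/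
/-- The function `B` of the general model. -/
noncomputable def Bgen (m ω α β φ : ℝ) : ℝ :=
  if φ ≤ 1 then (β + ω) * φ - ω * (α ^ 2 + 1 / m) * φ ^ 2 - ω * (m - 1) / m
  else β * φ - ω * α ^ 2 * φ ^ 2 + (m - 1) / m * ω * (φ ^ ((m - 2) / (m - 1)) - 1)

/-- The derivative of `Bgen` on the positive half-line. -/
noncomputable def BgenDeriv (m ω α β x : ℝ) : ℝ :=
  if x ≤ 1 then (β + ω) - 2 * ω * (α ^ 2 + 1 / m) * x
  else β - 2 * ω * α ^ 2 * x + (m - 2) / m * ω * x ^ ((m - 2) / (m - 1) - 1)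

theorem hasDerivAt_Bgen_left_formula (m ω α β x : ℝ) :
    HasDerivAt (fun φ : ℝ => (β + ω) * φ - ω * (α ^ 2 + 1 / m) * φ ^ 2 - ω * (m - 1) / m)
      ((β + ω) - 2 * ω * (α ^ 2 + 1 / m) * x) x := by
  have h := (((hasDerivAt_id x).const_mul (β + ω)).sub
    ((hasDerivAt_pow 2 x).const_mul (ω * (α ^ 2 + 1 / m)))).sub_const (ω * (m - 1) / m)
  refine h.congr_deriv ?_
  norm_num
  ring

theorem hasDerivAt_Bgen_right_formula {m x : ℝ} (ω α β : ℝ) (hm : 1 < m) (hx : 0 < x) :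
    HasDerivAt (fun φ : ℝ => β * φ - ω * α ^ 2 * φ ^ 2
        + (m - 1) / m * ω * (φ ^ ((m - 2) / (m - 1)) - 1))
      (β - 2 * ω * α ^ 2 * x + (m - 2) / m * ω * x ^ ((m - 2) / (m - 1) - 1)) x := by
  have h := (((hasDerivAt_id x).const_mul β).sub
    ((hasDerivAt_pow 2 x).const_mul (ω * α ^ 2))).add
    (((Real.hasDerivAt_rpow_const (p := (m - 2) / (m - 1)) (Or.inl hx.ne')).sub_const 1).const_mul
      ((m - 1) / m * ω))
  refine h.congr_deriv ?_
  have hm1 : m - 1 ≠ 0 := by linarith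
  have key : (m - 1) / m * ω * ((m - 2) / (m - 1) * x ^ ((m - 2) / (m - 1) - 1)) =
      (m - 2) / m * ω * x ^ ((m - 2) / (m - 1) - 1) := by
    generalize x ^ ((m - 2) / (m - 1) - 1) = y
    field_simp
  rw [key]
  norm_num
  ring

theorem hasDerivAt_Bgen {m x : ℝ} (ω α β : ℝ) (hm : 1 < m) (hx : 0 < x) :
    HasDerivAt (Bgen m ω α β) (BgenDeriv m ω α β x) x := by
  have hm0 : m ≠ 0 := by linarith
  rcases lt_trichotomy x 1 with h | h | h
  · rw [BgenDeriv, if_pos h.le]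
    refine (hasDerivAt_Bgen_left_formula m ω α β x).congr_of_eventuallyEq ?_
    filter_upwards [Iio_mem_nhds h] with y hy
    rw [Bgen, if_pos (le_of_lt hy)]
  · subst h
    have hl : HasDerivWithinAt (Bgen m ω α β) (BgenDeriv m ω α β 1) (Set.Iic 1) 1 := by
      rw [BgenDeriv, if_pos le_rfl]
      refine (hasDerivAt_Bgen_left_formula m ω α β 1).hasDerivWithinAt.congr_of_mem ?_ ?_
      · intro y hy
        rw [Bgen, if_pos (Set.mem_Iic.1 hy)]
      · simp
    have hr : HasDerivWithinAt (Bgen m ω α β) (BgenDeriv m ω α β 1) (Set.Ici 1) 1 := by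
      have h := (hasDerivAt_Bgen_right_formula ω α β hm one_pos).hasDerivWithinAt (s := Set.Ici 1)
      refine (h.congr_of_mem ?_ ?_).congr_deriv ?_
      · intro y hy
        rcases (Set.mem_Ici.1 hy).eq_or_lt with rfl | hy
        · rw [Bgen, if_pos le_rfl, Real.one_rpow]
          field_simp
          ring
        · rw [Bgen, if_neg hy.not_ge]
      · simp
      · rw [BgenDeriv, if_pos le_rfl, Real.one_rpow]
        field_simp
        ring
    have h := hl.union hr
    rwa [Set.Iic_union_Ici, hasDerivWithinAt_univ] at h
  · rw [BgenDeriv, if_neg h.not_ge]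
    refine (hasDerivAt_Bgen_right_formula ω α β hm hx).congr_of_eventuallyEq ?_
    filter_upwards [Ioi_mem_nhds h] with y hy
    rw [Bgen, if_neg (not_le_of_gt hy)]

theorem antitoneOn_BgenDeriv {m ω : ℝ} (α β : ℝ) (hm : 2 ≤ m) (hω : 0 < ω) :
    AntitoneOn (BgenDeriv m ω α β) (Set.Ioi 0) := by
  have hm0 : 0 < m := by linarith
  have hexp : (m - 2) / (m - 1) - 1 ≤ 0 := by
    rw [sub_nonpos, div_le_one (by linarith)]
    linarith
  have hcoef : 0 ≤ (m - 2) / m * ω :=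
    mul_nonneg (div_nonneg (by linarith) hm0.le) hω.le
  have hq : 0 ≤ 2 * ω * α ^ 2 := by positivity
  have hp : 0 ≤ 2 * ω * (1 / m) := by positivity
  have hmatch : (m - 2) / m * ω = ω - 2 * ω * (1 / m) := by
    field_simp
  intro x hx y _ hxy
  have hlin := mul_le_mul_of_nonneg_left hxy hq
  unfold BgenDeriv
  split_ifs with hy1 hx1 hx1
  · have := mul_le_mul_of_nonneg_left hxy hp
    linarith
  · linarith
  · have := mul_le_mul_of_nonneg_left hx1 hp
    have := mul_le_mul_of_nonneg_left
      (Real.rpow_le_one_of_one_le_of_nonpos (not_le.1 hy1).le hexp) hcoef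
    linarith
  · have := mul_le_mul_of_nonneg_left (Real.rpow_le_rpow_of_nonpos hx hxy hexp) hcoef
    linarith

theorem concaveOn_Bgen {m ω : ℝ} (α β : ℝ) (hm : 2 ≤ m) (hω : 0 < ω) :
    ConcaveOn ℝ (Set.Ioi 0) (Bgen m ω α β) := by
  have hd : ∀ x ∈ Set.Ioi (0 : ℝ), HasDerivAt (Bgen m ω α β) (BgenDeriv m ω α β x) x :=
    fun x hx => hasDerivAt_Bgen ω α β (by linarith) hx
  refine AntitoneOn.concaveOn_of_deriv (convex_Ioi 0)
    (fun x hx => (hd x hx).continuousAt.continuousWithinAt) ?_ ?_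
  · rw [interior_Ioi]
    exact fun x hx => (hd x hx).differentiableAt.differentiableWithinAt
  · rw [interior_Ioi]
    exact (antitoneOn_BgenDeriv α β hm hω).congr fun x hx => (hd x hx).deriv.symm

theorem deriv_deriv_Bgen_nonpos {m ω v : ℝ} (α β : ℝ) (hm : 2 ≤ m) (hω : 0 < ω) (hv : 0 < v) :
    deriv (deriv (Bgen m ω α β)) v ≤ 0 := by
  have hanti : AntitoneOn (deriv (Bgen m ω α β)) (Set.Ioi 0) :=
    (antitoneOn_BgenDeriv α β hm hω).congr fun x hx =>
      (hasDerivAt_Bgen ω α β (by linarith) hx).deriv.symm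
  rw [← derivWithin_of_isOpen isOpen_Ioi (Set.mem_Ioi.2 hv)]
  exact hanti.derivWithin_nonpos

/-- A convex function is nonpositive at the midpoint of two of its zeros. -/
theorem ConvexOn.not_pos_between_zeros {s : Set ℝ} {f : ℝ → ℝ} (hf : ConvexOn ℝ s f) {a b : ℝ}
    (ha : a ∈ s) (hb : b ∈ s) (hab : a < b) (hfa : f a = 0) (hfb : f b = 0) :
    ¬∀ v, a < v → v < b → 0 < f v := by
  intro hpos
  have h := hf.2 ha hb (by norm_num : (0 : ℝ) ≤ 1 / 2) (by norm_num : (0 : ℝ) ≤ 1 / 2)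
    (by norm_num)
  simp only [smul_eq_mul, hfa, hfb] at h
  have := hpos (1 / 2 * a + 1 / 2 * b) (by linarith) (by linarith)
  linarith

/-- Let `m ≥ 2`, `ω > 0`, `α β ∈ ℝ`.  Then `B` is concave on `(0,∞)`, with
`B″(v) ≤ 0` for every `v > 0`, `v ≠ 1`.  Consequently, for any `c K₀ ∈ ℝ`,
`G(v) = K₀ + cv - B(v)` is convex on `(0,∞)` and there are no points
`0 < v⁻ < v⁺` with `G(v⁻) = G(v⁺) = 0` and `G > 0` on `(v⁻, v⁺)`; i.e. no
increasing traveling wave profile can be constructed when `m ≥ 2`. -/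
theorem stmt_15 (m ω α β : ℝ) (hm : 2 ≤ m) (hω : 0 < ω) :
    ConcaveOn ℝ (Set.Ioi 0) (Bgen m ω α β) ∧
    (∀ v : ℝ, 0 < v → v ≠ 1 → deriv (deriv (Bgen m ω α β)) v ≤ 0) ∧
    ∀ c K₀ : ℝ,
      ConvexOn ℝ (Set.Ioi 0) (fun v => K₀ + c * v - Bgen m ω α β v) ∧
      ¬∃ vm vp : ℝ, 0 < vm ∧ vm < vp ∧
        K₀ + c * vm - Bgen m ω α β vm = 0 ∧
        K₀ + c * vp - Bgen m ω α β vp = 0 ∧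
        ∀ v : ℝ, vm < v → v < vp → 0 < K₀ + c * v - Bgen m ω α β v := by
  refine ⟨concaveOn_Bgen α β hm hω, fun v hv _ => deriv_deriv_Bgen_nonpos α β hm hω hv,
    fun c K₀ => ?_⟩
  have hG : ConvexOn ℝ (Set.Ioi 0) (fun v => K₀ + c * v - Bgen m ω α β v) := by
    refine ConvexOn.sub ⟨convex_Ioi 0, fun x _ y _ a b _ _ hab => le_of_eq ?_⟩
      (concaveOn_Bgen α β hm hω)
    simp only [smul_eq_mul]
    linear_combination (-K₀) * hab
  refine ⟨hG, ?_⟩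
  rintro ⟨vm, vp, hvm, hlt, h0, h1, hpos⟩
  exact hG.not_pos_between_zeros hvm (hvm.trans hlt) hlt h0 h1 hpos
end

section
/- Let ω > 0, m ∈ (1,2), α = β = 0, and let v⁻ satisfy m/2 < v⁻ < 1. Then there exists a unique real number v̄⁺ > 1 solving the secant equation B(v̄⁺) - B(v⁻) = B′(v⁻)·(v̄⁺ - v⁻). -/
/-- The function `B` of the general model with `α = β = 0`. -/
noncomputable def B0 (m ω v : ℝ) : ℝ :=
  if v ≤ 1 then ω * v - ω / m * v ^ 2 - ω * (m - 1) / m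
  else (m - 1) / m * ω * (v ^ ((m - 2) / (m - 1)) - 1)

lemma convexOn_rpow_of_nonpos {p : ℝ} (hp : p ≤ 0) :
    ConvexOn ℝ (Set.Ioi 0) fun x : ℝ => x ^ p := by
  refine ⟨convex_Ioi 0, fun x hx y hy a b ha hb hab => ?_⟩
  have hlog := strictConcaveOn_log_Ioi.concaveOn.2 hx hy ha hb hab
  have hexp := convexOn_exp.2 (Set.mem_univ (Real.log x * p)) (Set.mem_univ (Real.log y * p))
    ha hb hab
  have hxy : 0 < a • x + b • y := convex_Ioi (0 : ℝ) hx hy ha hb hab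
  simp only [Real.rpow_def_of_pos hxy, Real.rpow_def_of_pos (Set.mem_Ioi.mp hx),
    Real.rpow_def_of_pos (Set.mem_Ioi.mp hy)]
  refine (Real.exp_le_exp.mpr ?_).trans hexp
  simp only [smul_eq_mul] at hlog ⊢
  linarith [mul_le_mul_of_nonpos_right hlog hp]

/-- A convex function that is negative at `a` has at most one zero to the right of `a`. -/
lemma ConvexOn.eq_of_eq_zero_of_neg {s : Set ℝ} {f : ℝ → ℝ} {a x y : ℝ} (hf : ConvexOn ℝ s f)
    (ha : a ∈ s) (hx : x ∈ s) (hy : y ∈ s) (hfa : f a < 0) (hax : a < x) (hay : a < y)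
    (hfx : f x = 0) (hfy : f y = 0) : x = y := by
  rcases lt_trichotomy x y with h | h | h
  · have := hf.lt_right_of_left_lt ha hy (by rw [openSegment_eq_Ioo hay]; exact ⟨hax, h⟩)
      (by rw [hfx]; exact hfa)
    linarith
  · exact h
  · have := hf.lt_right_of_left_lt ha hx (by rw [openSegment_eq_Ioo hax]; exact ⟨hay, h⟩)
      (by rw [hfy]; exact hfa)
    linarith

lemma deriv_B0_of_lt_one (m ω : ℝ) {v : ℝ} (hv : v < 1) :
    deriv (B0 m ω) v = ω - ω / m * (2 * v) := by
  have heq : B0 m ω =ᶠ[nhds v] fun x => ω * x - ω / m * x ^ 2 - ω * (m - 1) / m := by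
    filter_upwards [Iio_mem_nhds hv] with x hx
    exact if_pos (le_of_lt hx)
  rw [heq.deriv_eq]
  have h := ((((hasDerivAt_id v).const_mul ω).sub
    (((hasDerivAt_id v).pow 2).const_mul (ω / m))).sub_const (ω * (m - 1) / m)).deriv
  simpa using h

/-- Let `ω > 0`, `m ∈ (1,2)`, `α = β = 0`, and let `v⁻` satisfy `m/2 < v⁻ < 1`.
Then there exists a unique real number `v̄⁺ > 1` solving the secant equation
`B(v̄⁺) - B(v⁻) = B′(v⁻)·(v̄⁺ - v⁻)`. -/
theorem stmt_17 (m ω vm : ℝ) (hm1 : 1 < m) (hm2 : m < 2) (hω : 0 < ω)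
    (h1 : m / 2 < vm) (h2 : vm < 1) :
    ∃! w : ℝ, 1 < w ∧ B0 m ω w - B0 m ω vm = deriv (B0 m ω) vm * (w - vm) := by
  have hm : 0 < m := by linarith
  set p := (m - 2) / (m - 1) with hp
  have hp0 : p ≤ 0 := div_nonpos_of_nonpos_of_nonneg (by linarith) (by linarith)
  set k := (m - 1) / m * ω with hk
  have hk0 : 0 < k := mul_pos (div_pos (by linarith) hm) hω
  set e := ω / m * (2 * vm) - ω with he
  have he0 : 0 < e := by
    have : e = ω / m * (2 * vm - m) := by rw [he]; field_simp
    rw [this]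
    exact mul_pos (div_pos hω hm) (by linarith)
  set q := ω / m * (1 - vm) ^ 2 with hq
  have hq0 : 0 < q := mul_pos (div_pos hω hm) (pow_pos (by linarith) 2)
  let G : ℝ → ℝ := fun w => k * (w ^ p - 1) - q + e * (w - 1)
  have hG : ∀ w, 1 < w →
      (B0 m ω w - B0 m ω vm = deriv (B0 m ω) vm * (w - vm) ↔ G w = 0) := by
    intro w hw
    have hGw : G w = B0 m ω w - B0 m ω vm - deriv (B0 m ω) vm * (w - vm) := by
      rw [deriv_B0_of_lt_one m ω h2]
      simp only [G, B0, if_neg (not_le.mpr hw), if_pos h2.le, ← hp, ← hk, hq, he]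
      field_simp
      ring
    rw [hGw, sub_eq_zero]
  have hG1 : G 1 < 0 := by simpa [G] using hq0
  have hconv : ConvexOn ℝ (Set.Ioi 0) G := by
    have h := ((convexOn_rpow_of_nonpos hp0).smul hk0.le).add
      ((((convexOn_id (convex_Ioi (0 : ℝ))).smul he0.le)).add_const (-k - q - e))
    refine h.congr fun w _ => ?_
    simp only [Pi.add_apply, smul_eq_mul, id, G]
    ring
  have hcont : ContinuousOn G (Set.Ioi 0) := hconv.continuousOn isOpen_Ioi
  set W := 1 + (k + q) / e with hW
  have hW1 : 1 < W := by
    have := div_pos (add_pos hk0 hq0) he0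
    linarith
  have hGW : 0 ≤ G W := by
    have h : e * (W - 1) = k + q := by rw [hW]; field_simp; ring
    have h' : 0 ≤ k * W ^ p := mul_nonneg hk0.le (Real.rpow_nonneg (by linarith) p)
    simp only [G]
    linarith
  obtain ⟨w, ⟨hw1, -⟩, hw⟩ := intermediate_value_Icc hW1.le
    (hcont.mono fun x hx => lt_of_lt_of_le one_pos hx.1) ⟨hG1.le, hGW⟩
  have hw1 : 1 < w := lt_of_le_of_ne hw1 fun h => by rw [← h] at hw; linarith
  refine ⟨w, ⟨hw1, (hG w hw1).mpr hw⟩, fun y ⟨hy1, hy⟩ => ?_⟩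
  exact hconv.eq_of_eq_zero_of_neg (Set.mem_Ioi.mpr one_pos) (Set.mem_Ioi.mpr (by linarith))
    (Set.mem_Ioi.mpr (by linarith)) hG1 hy1 hw1 ((hG y hy1).mp hy) hw
end

section
/- Let ω > 0, m ∈ (1,2), α = β = 0. Let v⁻ satisfy m/2 < v⁻ < 1 and let v⁺ > v̄⁺, where v̄⁺ > 1 is the unique root of the secant equation B(v̄⁺) - B(v⁻) = B′(v⁻)(v̄⁺ - v⁻). Define c := (B(v⁺) - B(v⁻))/(v⁺ - v⁻) and K₀ := B(v⁻) - c v⁻, and let G(v) := K₀ + cv - B(v). Then: (i) c < 0; (ii) G(v⁻) = G(v⁺) = 0; (iii) G′(v⁻) = c - B′(v⁻) > 0 and G′(v⁺) = c - B′(v⁺) < 0; and (iv) G(v) > 0 for all v ∈ (v⁻, v⁺). -/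
open Set

lemma B0_of_one_le {m ω v : ℝ} (hm : m ≠ 0) (hv : 1 ≤ v) :
    B0 m ω v = (m - 1) / m * ω * (v ^ ((m - 2) / (m - 1)) - 1) := by
  rcases hv.eq_or_lt with rfl | hv
  · simp only [B0, le_refl, if_true, Real.one_rpow]
    field_simp
  · simp [B0, not_le.mpr hv]

lemma B0_one {m ω : ℝ} (hm : m ≠ 0) : B0 m ω 1 = 0 := by
  simp [B0_of_one_le hm le_rfl]

lemma hasDerivAt_B0_of_lt_one {m ω v : ℝ} (hv : v < 1) :
    HasDerivAt (B0 m ω) (ω - ω / m * (2 * v)) v := by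
  have h : HasDerivAt (fun v : ℝ => ω * v - ω / m * v ^ 2 - ω * (m - 1) / m)
      (ω - ω / m * (2 * v)) v := by
    simpa using (((hasDerivAt_id v).const_mul ω).sub
      ((hasDerivAt_pow 2 v).const_mul (ω / m))).sub_const (ω * (m - 1) / m)
  refine h.congr_of_eventuallyEq ?_
  filter_upwards [Iio_mem_nhds hv] with w hw
  simp [B0, (mem_Iio.mp hw).le]

lemma hasDerivAt_B0_of_one_lt {m ω v : ℝ} (hm : m ≠ 0) (hv : 1 < v) :
    HasDerivAt (B0 m ω)
      ((m - 1) / m * ω * ((m - 2) / (m - 1) * v ^ ((m - 2) / (m - 1) - 1))) v := by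
  have h := ((Real.hasDerivAt_rpow_const (x := v) (p := (m - 2) / (m - 1))
    (Or.inl (by positivity))).sub_const 1).const_mul ((m - 1) / m * ω)
  refine h.congr_of_eventuallyEq ?_
  filter_upwards [Ioi_mem_nhds hv] with w hw
  exact B0_of_one_le hm (mem_Ioi.mp hw).le

lemma strictConvexOn_B0 {m ω : ℝ} (hm1 : 1 < m) (hm2 : m < 2) (hω : 0 < ω) :
    StrictConvexOn ℝ (Ici 1) (B0 m ω) := by
  have hm : m ≠ 0 := by positivity
  have he : (m - 2) / (m - 1) < 0 := div_neg_of_neg_of_pos (by linarith) (by linarith)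
  have hk : 0 < (m - 1) / m * ω := mul_pos (div_pos (by linarith) (by linarith)) hω
  refine StrictMonoOn.strictConvexOn_of_deriv (convex_Ici 1) ?_ ?_
  · refine ContinuousOn.congr (f := fun v : ℝ =>
      (m - 1) / m * ω * (v ^ ((m - 2) / (m - 1)) - 1)) ?_ fun v hv => B0_of_one_le hm hv
    refine continuousOn_const.mul (ContinuousOn.sub ?_ continuousOn_const)
    exact continuousOn_id.rpow_const fun v hv =>
      Or.inl (zero_lt_one.trans_le (mem_Ici.mp hv)).ne'
  · rw [interior_Ici]
    intro x hx y hy hxy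
    have hx1 : 1 < x := hx
    rw [(hasDerivAt_B0_of_one_lt hm hx).deriv, (hasDerivAt_B0_of_one_lt hm hy).deriv]
    exact mul_lt_mul_of_pos_left (mul_lt_mul_of_neg_left
      (Real.rpow_lt_rpow_of_neg (by linarith) hxy (by linarith)) he) hk

/-- Let `ω > 0`, `m ∈ (1,2)`, `α = β = 0`.  Let `m/2 < v⁻ < 1` and `v⁺ > v̄⁺`, where
`v̄⁺ > 1` is the root of the secant equation
`B(v̄⁺) - B(v⁻) = B′(v⁻)(v̄⁺ - v⁻)`.  With
`c := (B(v⁺) - B(v⁻))/(v⁺ - v⁻)`, `K₀ := B(v⁻) - c v⁻`, and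
`G(v) := K₀ + cv - B(v)`, one has: (i) `c < 0`; (ii) `G(v⁻) = G(v⁺) = 0`;
(iii) `G′(v⁻) = c - B′(v⁻) > 0` and `G′(v⁺) = c - B′(v⁺) < 0`;
(iv) `G > 0` on `(v⁻, v⁺)`. -/
theorem stmt_18 (m ω vm vbar vp : ℝ) (hm1 : 1 < m) (hm2 : m < 2) (hω : 0 < ω)
    (h1 : m / 2 < vm) (h2 : vm < 1) (hbar1 : 1 < vbar)
    (hbar2 : B0 m ω vbar - B0 m ω vm = deriv (B0 m ω) vm * (vbar - vm))
    (hvp : vbar < vp) :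
    let c : ℝ := (B0 m ω vp - B0 m ω vm) / (vp - vm)
    let K₀ : ℝ := B0 m ω vm - c * vm
    let G : ℝ → ℝ := fun v => K₀ + c * v - B0 m ω v
    c < 0 ∧
    G vm = 0 ∧ G vp = 0 ∧
    deriv G vm = c - deriv (B0 m ω) vm ∧ 0 < deriv G vm ∧
    deriv G vp = c - deriv (B0 m ω) vp ∧ deriv G vp < 0 ∧
    (∀ v : ℝ, vm < v → v < vp → 0 < G v) := by
  have hm : m ≠ 0 := by positivity
  have hconv := strictConvexOn_B0 hm1 hm2 hω
  have hB1 : B0 m ω 1 = 0 := B0_one hm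
  have hdm : HasDerivAt (B0 m ω) _ vm := hasDerivAt_B0_of_lt_one h2
  have hdp := (hasDerivAt_B0_of_one_lt (ω := ω) hm (hbar1.trans hvp)).differentiableAt.hasDerivAt
  have hvmp : 0 < vp - vm := by linarith
  have htangent : ∀ v ≤ 1, B0 m ω v =
      B0 m ω vm + deriv (B0 m ω) vm * (v - vm) - ω / m * (v - vm) ^ 2 := by
    intro v hv
    rw [hdm.deriv]
    simp only [B0, hv, h2.le, if_true]
    ring
  have hωm : 0 < ω / m := by positivity
  have hBm : 0 < B0 m ω vm := by
    have : B0 m ω vm = ω / m * ((1 - vm) * (vm - (m - 1))) := by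
      simp only [B0, h2.le, if_true]
      field_simp
      ring
    rw [this]
    exact mul_pos hωm (mul_pos (by linarith) (by linarith))
  have hBp : B0 m ω vp < 0 := by
    rw [B0_of_one_le hm (by linarith)]
    refine mul_neg_of_pos_of_neg (mul_pos (div_pos (by linarith) (by linarith)) hω) ?_
    linarith [Real.rpow_lt_one_of_one_lt_of_neg (hbar1.trans hvp)
      (div_neg_of_neg_of_pos (by linarith : m - 2 < 0) (by linarith : 0 < m - 1))]
  have hchord : ∀ v, 1 < v → v < vp → B0 m ω v * (vp - 1) < (v - 1) * B0 m ω vp := by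
    intro v hv hvp'
    have h := hconv.slope_strict_mono_adjacent (mem_Ici.mpr le_rfl)
      (mem_Ici.mpr (hv.trans hvp').le) hv hvp'
    rw [hB1, div_lt_div_iff₀ (by linarith) (by linarith)] at h
    linarith
  intro c K₀ G
  have hc : c * (vp - vm) = B0 m ω vp - B0 m ω vm := div_mul_cancel₀ _ hvmp.ne'
  have hGdef : ∀ v, G v = B0 m ω vm + c * (v - vm) - B0 m ω v := fun v => by
    simp only [G, K₀]
    ring
  have hGderiv : ∀ {v d : ℝ}, HasDerivAt (B0 m ω) d v → HasDerivAt G (c - d) v := by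
    intro v d h
    have h' := (((hasDerivAt_id v).const_mul c).const_add K₀).sub h
    rw [mul_one] at h'
    exact h'
  have hslope : deriv (B0 m ω) vm < c := by
    have h := hchord vbar hbar1 hvp
    have hone := htangent 1 le_rfl
    rw [hB1] at hone
    have hsq : 0 < ω / m * (1 - vm) ^ 2 := mul_pos hωm (pow_pos (by linarith) 2)
    set d := deriv (B0 m ω) vm
    have hT : 0 < B0 m ω vm + d * (1 - vm) := by linarith
    have key : (vbar - 1) * (d * (vp - vm)) < (vbar - 1) * (c * (vp - vm)) := by
      rw [hc]
      have hbar : B0 m ω vbar = B0 m ω vm + d * (vbar - vm) := by linarith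
      rw [hbar] at h
      nlinarith [mul_pos hT (sub_pos.mpr hvp)]
    exact lt_of_mul_lt_mul_right (lt_of_mul_lt_mul_left key (by linarith)) hvmp.le
  have hleft : ∀ v, vm < v → v ≤ 1 → 0 < G v := by
    intro v hv hv1
    rw [hGdef, htangent v hv1]
    nlinarith [mul_pos (sub_pos.mpr hslope) (sub_pos.mpr hv), mul_nonneg hωm.le (sq_nonneg (v - vm))]
  have hG1 : 0 < B0 m ω vm + c * (1 - vm) := by
    have h := hleft 1 h2 le_rfl
    rwa [hGdef, hB1, sub_zero] at h
  have hBp_eq : B0 m ω vp = B0 m ω vm + c * (vp - vm) := by linarith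
  refine ⟨div_neg_of_neg_of_pos (by linarith) hvmp, by rw [hGdef]; ring,
    by rw [hGdef]; linarith, ?_, ?_, (hGderiv hdp).deriv, ?_, ?_⟩
  · rw [hdm.deriv]
    exact (hGderiv hdm).deriv
  · rw [(hGderiv hdm).deriv, ← hdm.deriv]
    linarith
  · rw [(hGderiv hdp).deriv]
    have h := hconv.slope_lt_deriv (mem_Ici.mpr le_rfl) (mem_Ici.mpr (hbar1.trans hvp).le)
      (hbar1.trans hvp) hdp.differentiableAt
    rw [slope_def_field, hB1, div_lt_iff₀ (by linarith)] at h
    have : c * (vp - 1) < deriv (B0 m ω) vp * (vp - 1) := by linarith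
    linarith [lt_of_mul_lt_mul_right this (by linarith)]
  · intro v hv hvp'
    rcases le_or_gt v 1 with hv1 | hv1
    · exact hleft v hv hv1
    · have h := hchord v hv1 hvp'
      rw [hGdef]
      refine pos_of_mul_pos_left (b := vp - 1) ?_ (by linarith)
      rw [hBp_eq] at h
      nlinarith [mul_pos hG1 (sub_pos.mpr hvp')]
end
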